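/- Let (R, 𝔪) be a Noetherian local ring with dim R > 0 and R/𝔪 infinite, let I be a proper ideal, let M be a finitely generated R-module, and let d be a positive integer with dim_R M ≤ d. Suppose I is generated by d elements and b ∈ I \ 𝔪I. Then one can choose general elements a_1, …, a_{d−1} of I that generate I together with b, and in this case j_d(I, M) = length_R( M / ( ((a_1, …, a_{d−1})M :_M I^∞) + bM ) ). -/

import Mathlib

open Filter

noncomputable section

/-- The length of a module, as the height of `⊤` in the submodule lattice. -/
def mLength (R M : Type*) [CommRing R] [AddCommGroup M] [Module R M] : ℕ∞ :=
  Order.height (⊤ : Submodule R M)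

/-- The Krull dimension of a module, via the annihilator. -/
def mDim (R M : Type*) [CommRing R] [AddCommGroup M] [Module R M] : WithBot ℕ∞ :=
  ringKrullDim (R ⧸ Module.annihilator R M)

/-- `H⁰_I(N)`: elements killed by a power of `I` (0-th local cohomology). -/
def H0 {R : Type*} [CommRing R] (I : Ideal R) (N : Type*) [AddCommGroup N] [Module R N] :
    Submodule R N :=
  ⨆ n : ℕ, Submodule.torsionBySet R N ((I ^ n : Ideal R) : Set R)

/-- `IⁿM/I^{n+1}M`, as a submodule of `M/I^{n+1}M`. -/
def gradedPiece {R : Type*} [CommRing R] (I : Ideal R) {M : Type*} [AddCommGroup M]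
    [Module R M] (n : ℕ) : Submodule R (M ⧸ (I ^ (n + 1) • ⊤ : Submodule R M)) :=
  Submodule.map (I ^ (n + 1) • ⊤ : Submodule R M).mkQ (I ^ n • ⊤ : Submodule R M)

/-- The `j`-multiplicity `j_d(I, M)`, defined as
`lim_n (d−1)!/n^(d−1) · length_R (H⁰_𝔪(IⁿM/I^{n+1}M))`. -/
def jMult {R : Type*} [CommRing R] (𝔪 I : Ideal R) (M : Type*) [AddCommGroup M]
    [Module R M] (d : ℕ) : ℝ :=
  limUnder atTop fun n : ℕ =>
    ((d - 1).factorial : ℝ) / (n : ℝ) ^ (d - 1) *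
      ((mLength R (H0 𝔪 (gradedPiece I (M := M) n))).toNat : ℝ)

/-- The Hilbert–Samuel multiplicity `e(I; N)` of a `d`-dimensional module `N`
(equal to `0` if `N = 0`), defined as `lim_n d!/n^d · length_R (N/IⁿN)`. -/
def hsMult {R : Type*} [CommRing R] (I : Ideal R) (N : Type*) [AddCommGroup N]
    [Module R N] (d : ℕ) : ℝ :=
  limUnder atTop fun n : ℕ =>
    (d.factorial : ℝ) / (n : ℝ) ^ d *
      ((mLength R (N ⧸ (I ^ n • ⊤ : Submodule R N))).toNat : ℝ)

/-- `K :_M I^∞ = ⋃ₙ (K :_M Iⁿ)`. -/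
def satur {R : Type*} [CommRing R] (I : Ideal R) {M : Type*} [AddCommGroup M] [Module R M]
    (K : Submodule R M) : Submodule R M :=
  Submodule.comap K.mkQ (H0 I (M ⧸ K))

/-- "For general elements `a₁, …, aᵢ` of `I`", i.e. for all `i`-tuples of elements of `I`
whose coefficient vectors with respect to any finite generating set of `I` avoid the zero
locus of some nonzero polynomial over the residue field `R/𝔪` (equivalently, whose images
lie in a suitable nonempty Zariski-open set of choices modulo `𝔪I`), property `P` holds. -/
def GeneralElts {R : Type*} [CommRing R] (𝔪 I : Ideal R) (i : ℕ)
    (P : (Fin i → R) → Prop) : Prop :=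
  ∀ (m : ℕ) (x : Fin m → R), Ideal.span (Set.range x) = I →
    ∃ F : MvPolynomial (Fin i × Fin m) R,
      MvPolynomial.map (Ideal.Quotient.mk 𝔪) F ≠ 0 ∧
      ∀ c : Fin i × Fin m → R,
        MvPolynomial.eval (fun p => Ideal.Quotient.mk 𝔪 (c p))
          (MvPolynomial.map (Ideal.Quotient.mk 𝔪) F) ≠ 0 →
        P fun j => ∑ l, c (j, l) * x l

/-- The length of `(A + B) / B` for submodules `A`, `B`, as a quotient of `A`. -/
def relLength {R M : Type*} [CommRing R] [AddCommGroup M] [Module R M]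
    (A B : Submodule R M) : ℕ∞ :=
  Module.length R (A ⧸ B.submoduleOf A)

section RelLength

variable {R M : Type*} [CommRing R] [AddCommGroup M] [Module R M]

lemma relLength_inf (A B : Submodule R M) : relLength A (A ⊓ B) = relLength A B := by
  unfold relLength
  rw [show (A ⊓ B).submoduleOf A = B.submoduleOf A by ext x; simp [Submodule.submoduleOf]]

lemma relLength_sup (A B : Submodule R M) : relLength (A ⊔ B) B = relLength A B := by
  rw [← relLength_inf A B]
  unfold relLength
  exact (LinearMap.quotientInfEquivSupQuotient A B).length_eq.symm

lemma relLength_comap {M' : Type*} [AddCommGroup M'] [Module R M'] (f : M →ₗ[R] M')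
    (A : Submodule R M) (B : Submodule R M') :
    relLength A (B.comap f) = relLength (A.map f) B := by
  unfold relLength
  let φ : A →ₗ[R] (A.map f) ⧸ B.submoduleOf (A.map f) :=
    (B.submoduleOf (A.map f)).mkQ ∘ₗ f.submoduleMap A
  have hφ : Function.Surjective φ :=
    (Submodule.mkQ_surjective _).comp (f.submoduleMap_surjective A)
  have hk : LinearMap.ker φ = (B.comap f).submoduleOf A := by
    ext x
    change Submodule.Quotient.mk (f.submoduleMap A x) = _ ↔ _
    rw [Submodule.Quotient.mk_eq_zero]
    rfl
  rw [← hk]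
  exact (φ.quotKerEquivOfSurjective hφ).length_eq

lemma relLength_map_mkQ (A B : Submodule R M) :
    Module.length R (A.map B.mkQ) = relLength A B := by
  have h := relLength_comap B.mkQ A ⊥
  rw [show (⊥ : Submodule R (M ⧸ B)).comap B.mkQ = B by
    rw [Submodule.comap_bot, Submodule.ker_mkQ]] at h
  rw [h]
  unfold relLength
  rw [show (⊥ : Submodule R (M ⧸ B)).submoduleOf (A.map B.mkQ) = ⊥ by
    simp [Submodule.submoduleOf]]
  exact (Submodule.quotEquivOfEqBot _ rfl).symm.length_eq

lemma relLength_top (B : Submodule R M) : relLength ⊤ B = Module.length R (M ⧸ B) := by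
  rw [← relLength_map_mkQ, Submodule.map_top, Submodule.range_mkQ, Module.length_top]

lemma relLength_eq_zero {A B : Submodule R M} : relLength A B = 0 ↔ A ≤ B := by
  unfold relLength
  rw [Module.length_eq_zero_iff, Submodule.Quotient.subsingleton_iff,
    Submodule.submoduleOf_eq_top]

lemma relLength_add {A B C : Submodule R M} (hCB : C ≤ B) (hBA : B ≤ A) :
    relLength A C = relLength A B + relLength B C := by
  have hle : A.map C.mkQ ≥ B.map C.mkQ := Submodule.map_mono hBA
  rw [← relLength_map_mkQ A C, ← relLength_map_mkQ B C, ← relLength_map_mkQ A B, add_comm]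
  let g : A.map C.mkQ →ₗ[R] A.map B.mkQ :=
    (Submodule.factor hCB).restrict (by
      rintro _ ⟨x, hx, rfl⟩
      exact ⟨x, hx, rfl⟩)
  refine Module.length_eq_add_of_exact (Submodule.inclusion hle) g
    (Submodule.inclusion_injective _) ?_ ?_
  · rintro ⟨_, x, hx, rfl⟩
    exact ⟨⟨C.mkQ x, x, hx, rfl⟩, rfl⟩
  · rintro ⟨_, x, hx, rfl⟩
    constructor
    · intro h
      have h1 : (Submodule.Quotient.mk x : M ⧸ B) = 0 := congrArg Subtype.val h
      rw [Submodule.Quotient.mk_eq_zero] at h1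
      exact ⟨⟨C.mkQ x, x, h1, rfl⟩, rfl⟩
    · rintro ⟨⟨_, y, hy, rfl⟩, h⟩
      have h1 : C.mkQ y = C.mkQ x := congrArg Subtype.val h
      have h2 : B.mkQ x = B.mkQ y := by
        have := congrArg (Submodule.factor hCB) h1
        exact this.symm
      have h3 : B.mkQ y = 0 := by simpa using hy
      exact Subtype.ext (h2.trans h3)

lemma relLength_mono {A A' B : Submodule R M} (h : A ≤ A') :
    relLength A B ≤ relLength A' B := by
  rw [← relLength_sup A, ← relLength_sup A',
    relLength_add (le_sup_right : B ≤ A ⊔ B) (sup_le_sup_right h B)]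
  exact le_add_self

lemma relLength_span_singleton [IsLocalRing R] {z : M} {Z : Submodule R M} (hz : z ∉ Z)
    (hm : ∀ c ∈ IsLocalRing.maximalIdeal R, c • z ∈ Z) :
    relLength (Submodule.span R {z}) Z = 1 := by
  have h1 := relLength_comap (LinearMap.toSpanSingleton R M z) ⊤ Z
  rw [Submodule.map_top, LinearMap.range_toSpanSingleton] at h1
  have h2 : Z.comap (LinearMap.toSpanSingleton R M z) = IsLocalRing.maximalIdeal R := by
    refine ((IsLocalRing.maximalIdeal.isMaximal R).eq_of_le ?_ ?_).symm
    · intro h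
      apply hz
      have : (1 : R) ∈ Z.comap (LinearMap.toSpanSingleton R M z) := by rw [h]; trivial
      simpa using this
    · intro c hc
      simpa using hm c hc
  rw [← h1, h2, relLength_top]
  have : IsSimpleModule R (R ⧸ IsLocalRing.maximalIdeal R) :=
    isSimpleModule_iff_isCoatom.mpr (IsLocalRing.maximalIdeal.isMaximal R).out
  exact Module.length_eq_one R _

lemma mLength_eq_length : mLength R M = Module.length R M :=
  (Module.length_eq_height R M).symm

end RelLength

/-- `(𝔄, b)` is a system of linear coordinates on the ideal generated by `g`, in which
`p` is the rational point `𝔄 = 0`, `b = 1`. -/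
structure IsCoord {R ι : Type*} [CommRing R] (g : ι → R) (𝔄 : Ideal R) (b : R) (p : ι → R) :
    Prop where
  exists_form : ∀ c ∈ 𝔄, ∃ F : MvPolynomial ι R,
    F.IsHomogeneous 1 ∧ F.eval g = c ∧ F.eval p = 0
  exists_unit_form : ∃ F : MvPolynomial ι R, F.IsHomogeneous 1 ∧ F.eval g = b ∧ F.eval p = 1
  sub_mem : ∀ i, g i - p i * b ∈ 𝔄

namespace IsCoord

variable {R ι : Type*} [CommRing R] {g : ι → R} {𝔄 : Ideal R} {b : R} {p : ι → R}

lemma le_span (h : IsCoord g 𝔄 b p) : 𝔄 ≤ Ideal.span (Set.range g) := by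
  intro c hc
  obtain ⟨F, hF, h1, -⟩ := h.exists_form c hc
  exact (Ideal.mem_span_iff_exists_isHomogeneous g c).2 ⟨F, hF, h1⟩

lemma mem_span (h : IsCoord g 𝔄 b p) : b ∈ Ideal.span (Set.range g) := by
  obtain ⟨F, hF, h1, -⟩ := h.exists_unit_form
  exact (Ideal.mem_span_iff_exists_isHomogeneous g b).2 ⟨F, hF, h1⟩

lemma span_eq (h : IsCoord g 𝔄 b p) : Ideal.span (Set.range g) = Ideal.span {b} ⊔ 𝔄 := by
  refine le_antisymm (Ideal.span_le.2 ?_)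
    (sup_le ((Ideal.span_singleton_le_iff_mem _).2 h.mem_span) h.le_span)
  rintro _ ⟨i, rfl⟩
  have : g i = p i * b + (g i - p i * b) := by ring
  rw [this]
  exact Submodule.add_mem_sup (Ideal.mul_mem_left _ _ (Ideal.mem_span_singleton_self b))
    (h.sub_mem i)

lemma prod_sub_mem (h : IsCoord g 𝔄 b p) (s : Multiset ι) :
    (s.map g).prod - (s.map fun i => p i * b).prod ∈
      𝔄 * Ideal.span (Set.range g) ^ (s.card - 1) := by
  induction s using Multiset.induction with
  | empty => simp
  | cons i s ih =>
    simp only [Multiset.map_cons, Multiset.prod_cons, Multiset.card_cons, Nat.add_sub_cancel]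
    have e : g i * (s.map g).prod - p i * b * (s.map fun i => p i * b).prod =
      (g i - p i * b) * (s.map g).prod +
        p i * b * ((s.map g).prod - (s.map fun i => p i * b).prod) := by ring
    rw [e]
    have hpow : ∀ t : Multiset ι,
        (t.map g).prod ∈ Ideal.span (Set.range g) ^ t.card := by
      intro t
      induction t using Multiset.induction with
      | empty => simp
      | cons j t iht =>
        rw [Multiset.map_cons, Multiset.prod_cons, Multiset.card_cons, pow_succ']
        exact Ideal.mul_mem_mul (Ideal.subset_span ⟨j, rfl⟩) iht
    refine add_mem (Ideal.mul_mem_mul (h.sub_mem i) (hpow s)) ?_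
    rcases Nat.eq_zero_or_pos s.card with h0 | h0
    · rw [Multiset.card_eq_zero] at h0
      simp [h0]
    · have := Ideal.mul_mem_mul (Ideal.mul_mem_left _ (p i) h.mem_span) ih
      rwa [mul_left_comm, ← pow_succ', Nat.sub_add_cancel h0] at this

/-- Expansion of a form around the point `p`. -/
lemma eval_sub_mem (h : IsCoord g 𝔄 b p) {F : MvPolynomial ι R} {e : ℕ}
    (hF : F.IsHomogeneous e) {𝔠 : Ideal R} (hc : ∀ m, F.coeff m ∈ 𝔠) :
    F.eval g - F.eval p * b ^ e ∈ 𝔠 * (𝔄 * Ideal.span (Set.range g) ^ (e - 1)) := by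
  rw [MvPolynomial.eval_eq, MvPolynomial.eval_eq, Finset.sum_mul, ← Finset.sum_sub_distrib]
  refine sum_mem fun m hm => ?_
  have hdeg : (Finsupp.toMultiset m).card = e := by
    rw [Finsupp.card_toMultiset]
    by_contra hne
    exact MvPolynomial.mem_support_iff.1 hm (hF.coeff_eq_zero hne)
  have key := h.prod_sub_mem (Finsupp.toMultiset m)
  rw [hdeg, Multiset.map_congr rfl (fun i _ => rfl), Multiset.prod_map_mul, Multiset.map_const',
    Multiset.prod_replicate, hdeg] at key
  have hp : ∀ v : ι → R, ((Finsupp.toMultiset m).map v).prod = ∏ i ∈ m.support, v i ^ m i := by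
    intro v
    rw [Finsupp.toMultiset_map, Finsupp.prod_toMultiset, Finsupp.prod_mapDomain_index]
    · rfl
    · simp
    · intros; rw [pow_add]
  rw [hp, hp] at key
  have := Ideal.mul_mem_mul (hc m) key
  convert this using 1
  ring

lemma exists_form_of_mem_mul (h : IsCoord g 𝔄 b p) {j : ℕ} {c : R}
    (hc : c ∈ 𝔄 * Ideal.span (Set.range g) ^ j) :
    ∃ F : MvPolynomial ι R, F.IsHomogeneous (j + 1) ∧ F.eval g = c ∧ F.eval p = 0 := by
  refine Submodule.mul_induction_on hc ?_ ?_
  · intro x hx y hy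
    obtain ⟨F, hF, h1, h2⟩ := h.exists_form x hx
    obtain ⟨G, hG, h3⟩ := (Ideal.mem_span_pow_iff_exists_isHomogeneous g y).1 hy
    refine ⟨F * G, ?_, by simp [h1, h3], by simp [h2]⟩
    rw [add_comm]
    exact hF.mul hG
  · rintro x y ⟨F, hF, h1, h2⟩ ⟨G, hG, h3, h4⟩
    exact ⟨F + G, hF.add hG, by simp [h1, h3], by simp [h2, h4]⟩

lemma span_pow_succ_le (h : IsCoord g 𝔄 b p) (j : ℕ) :
    Ideal.span (Set.range g) ^ (j + 1) ≤
      Ideal.span {b ^ (j + 1)} ⊔ 𝔄 * Ideal.span (Set.range g) ^ j := by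
  intro c hc
  obtain ⟨F, hF, rfl⟩ := (Ideal.mem_span_pow_iff_exists_isHomogeneous g c).1 hc
  have := h.eval_sub_mem hF (𝔠 := ⊤) (fun _ => trivial)
  rw [Ideal.top_mul, Nat.add_sub_cancel] at this
  rw [← add_sub_cancel (F.eval p * b ^ (j + 1)) (F.eval g)]
  exact Submodule.add_mem_sup
    (Ideal.mul_mem_left _ _ (Ideal.mem_span_singleton_self _)) this

end IsCoord

/-- The filtration `n ↦ I^(n+1) M`. -/
def shiftFiltration {R : Type*} [CommRing R] (I : Ideal R) (M : Type*) [AddCommGroup M]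
    [Module R M] : I.Filtration M where
  N i := I ^ (i + 1) • ⊤
  mono i := Submodule.smul_mono_left (Ideal.pow_le_pow_right (by omega))
  smul_le i := by rw [← mul_smul, ← pow_succ']

/-- The multiplicity of the graded module `Y / ⨁ I^(n+1) M` at the point `𝔄 = 0` is `r`. -/
def HasFiberLength {R M : Type*} [CommRing R] [AddCommGroup M] [Module R M] {I : Ideal R}
    (𝔄 : Ideal R) (Y : I.Filtration M) (r : ℕ) : Prop :=
  ∃ n₀, ∀ n ≥ n₀,
    relLength (Y.N (n + 1)) (𝔄 • Y.N n ⊔ (shiftFiltration I M).N (n + 1)) = r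

/-- Relations `∑ aᵢ yᵢ ∈ ⨁ I^(n+1) M` with `aᵢ ∈ 𝔄` and `yᵢ ∈ Y` are, up to a power of `b`,
induced by such relations with `yᵢ ∈ ⨁ I^(n+1) M`. -/
def IsTorFree {R M : Type*} [CommRing R] [AddCommGroup M] [Module R M] {I : Ideal R}
    (𝔄 : Ideal R) (b : R) (Y : I.Filtration M) : Prop :=
  ∃ E, ∀ n, ∀ w ∈ 𝔄 • Y.N n, w ∈ (shiftFiltration I M).N (n + 1) →
    b ^ E • w ∈ 𝔄 • (shiftFiltration I M).N (n + E)

section FiberMultiplicity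

variable {R M ι : Type*} [CommRing R] [AddCommGroup M] [Module R M] {I : Ideal R}
  {g : ι → R} {𝔄 : Ideal R} {b : R} {p : ι → R}

lemma span_singleton_smul_eq_map (c : R) (N : Submodule R M) :
    Ideal.span {c} • N = N.map (LinearMap.lsmul R M c) := by
  ext x
  rw [Submodule.mem_map]
  constructor
  · intro hx
    refine Submodule.smul_induction_on hx ?_ ?_
    · intro r hr n hn
      obtain ⟨s, rfl⟩ := Ideal.mem_span_singleton'.1 hr
      exact ⟨s • n, N.smul_mem _ hn, by simp [smul_smul, mul_comm]⟩
    · rintro _ _ ⟨y, hy, rfl⟩ ⟨z, hz, rfl⟩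
      exact ⟨y + z, N.add_mem hy hz, by simp⟩
  · rintro ⟨y, hy, rfl⟩
    exact Submodule.smul_mem_smul (Ideal.mem_span_singleton_self c) hy

lemma pow_smul_mem_filtration (Y : I.Filtration M) {c : R} {k n : ℕ} (hc : c ∈ I ^ k) {y : M}
    (hy : y ∈ Y.N n) : c • y ∈ Y.N (n + k) := by
  rw [add_comm]
  exact Y.pow_smul_le k n (Submodule.smul_mem_smul hc hy)

lemma smul_filtration_le (hA : 𝔄 ≤ I) (Y : I.Filtration M) (n : ℕ) :
    𝔄 • Y.N n ≤ Y.N (n + 1) :=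
  (Submodule.smul_mono_left hA).trans (Y.smul_le n)

lemma pow_smul_mem_smul_filtration (Y : I.Filtration M) {c : R} {k n : ℕ} (hc : c ∈ I ^ k) {y : M}
    (hy : y ∈ 𝔄 • Y.N n) : c • y ∈ 𝔄 • Y.N (n + k) := by
  refine Submodule.smul_induction_on hy ?_ ?_
  · intro a ha z hz
    rw [smul_comm]
    exact Submodule.smul_mem_smul ha (pow_smul_mem_filtration Y hc hz)
  · intro y z hy hz
    rw [smul_add]
    exact add_mem hy hz

lemma mul_smul_mem_smul_filtration (Y : I.Filtration M) {c : R} {k n : ℕ} (hc : c ∈ 𝔄 * I ^ k)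
    {y : M} (hy : y ∈ Y.N n) : c • y ∈ 𝔄 • Y.N (n + k) := by
  have := Submodule.smul_mem_smul hc hy
  rw [mul_smul] at this
  rw [add_comm]
  exact smul_mono_right 𝔄 (Y.pow_smul_le k n) this

/-- The submodules `𝔄 Yₙ + I^(n+2) M` of `Yₙ₊₁`. -/
def fiberKernel (𝔄 : Ideal R) (Y : I.Filtration M) (n : ℕ) : Submodule R M :=
  𝔄 • Y.N n ⊔ (shiftFiltration I M).N (n + 1)

lemma fiberKernel_le (hA : 𝔄 ≤ I) {Y : I.Filtration M} (hY : shiftFiltration I M ≤ Y) (n : ℕ) :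
    fiberKernel 𝔄 Y n ≤ Y.N (n + 1) :=
  sup_le (smul_filtration_le hA Y n) (hY (n + 1))

lemma fiberKernel_mono {Y Y' : I.Filtration M} (h : Y ≤ Y') (n : ℕ) :
    fiberKernel 𝔄 Y n ≤ fiberKernel 𝔄 Y' n :=
  sup_le_sup_right (smul_mono_right _ (h n)) _

lemma pow_smul_mem_fiberKernel (Y : I.Filtration M) {c : R} {k n : ℕ} (hc : c ∈ I ^ k) {y : M}
    (hy : y ∈ fiberKernel 𝔄 Y n) : c • y ∈ fiberKernel 𝔄 Y (n + k) := by
  obtain ⟨u, hu, v, hv, rfl⟩ := Submodule.mem_sup.1 hy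
  rw [smul_add]
  refine Submodule.add_mem_sup (pow_smul_mem_smul_filtration Y hc hu) ?_
  have := pow_smul_mem_filtration _ hc hv
  rwa [add_right_comm] at this

lemma IsCoord.filtration_le (h : IsCoord g 𝔄 b p) (hg : Ideal.span (Set.range g) = I)
    {Y : I.Filtration M} (hs : Y.Stable) :
    ∃ n₀, ∀ n ≥ n₀, ∀ e,
      Y.N (n + 1 + e) ≤ (Y.N (n + 1)).map (LinearMap.lsmul R M (b ^ e)) ⊔ 𝔄 • Y.N (n + e) := by
  obtain ⟨n₀, hn₀⟩ := hs.exists_pow_smul_eq_of_ge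
  refine ⟨n₀, fun n hn e => ?_⟩
  rcases e with _ | e
  · refine le_sup_of_le_left ?_
    intro x hx
    exact ⟨x, hx, by simp⟩
  · have h1 : Y.N (n + 1 + (e + 1)) = I ^ (e + 1) • Y.N (n + 1) := by
      rw [hn₀ _ (by omega), hn₀ (n + 1) (by omega), ← mul_smul, ← pow_add]
      congr 2
      omega
    rw [h1, ← span_singleton_smul_eq_map]
    have h2 := h.span_pow_succ_le e
    rw [hg] at h2
    refine (Submodule.smul_mono_left h2).trans ?_
    rw [Submodule.sup_smul, mul_smul]
    refine sup_le_sup_left (smul_mono_right _ ?_) _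
    refine (Y.pow_smul_le e (n + 1)).trans_eq ?_
    congr 1
    omega

lemma HasFiberLength.injective (h : IsCoord g 𝔄 b p) (hg : Ideal.span (Set.range g) = I)
    {Y : I.Filtration M} (hY : shiftFiltration I M ≤ Y) (hs : Y.Stable) {r : ℕ}
    (hr : HasFiberLength 𝔄 Y r) :
    ∃ n₀, ∀ n ≥ n₀, ∀ k, ∀ y ∈ Y.N (n + 1), b ^ k • y ∈ fiberKernel 𝔄 Y (n + k) →
      y ∈ fiberKernel 𝔄 Y n := by
  have hA : 𝔄 ≤ I := hg ▸ h.le_span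
  have hb : b ∈ I := hg ▸ h.mem_span
  obtain ⟨n₁, h₁⟩ := h.filtration_le hg hs
  obtain ⟨n₂, h₂⟩ := hr
  have step : ∀ n ≥ max n₁ n₂, ∀ y ∈ Y.N (n + 1), b • y ∈ fiberKernel 𝔄 Y (n + 1) →
      y ∈ fiberKernel 𝔄 Y n := by
    intro n hn y hy hby
    set β := LinearMap.lsmul R M b
    set Z := Y.N (n + 1) ⊓ (fiberKernel 𝔄 Y (n + 1)).comap β with hZ
    have hNZ : fiberKernel 𝔄 Y n ≤ Z := by
      refine le_inf (fiberKernel_le hA hY n) fun z hz => ?_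
      exact pow_smul_mem_fiberKernel (k := 1) Y (by simpa using hb) hz
    have e1 : relLength (Y.N (n + 1)) Z = r := by
      rw [hZ, relLength_inf, relLength_comap, ← relLength_sup, ← h₂ (n + 1) (by omega)]
      congr 1
      refine le_antisymm (sup_le ?_ (fiberKernel_le hA hY _)) ?_
      · rintro _ ⟨z, hz, rfl⟩
        exact pow_smul_mem_filtration (k := 1) Y (by simpa using hb) hz
      · have := h₁ n (by omega) 1
        rw [pow_one] at this
        exact this.trans (sup_le_sup_left le_sup_left _)
    have e2 := relLength_add hNZ (inf_le_left : Z ≤ Y.N (n + 1))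
    have e3 : relLength (Y.N (n + 1)) (fiberKernel 𝔄 Y n) = r := h₂ n (by omega)
    rw [e1, e3] at e2
    have e4 : relLength Z (fiberKernel 𝔄 Y n) = 0 := by
      have : (r : ℕ∞) + 0 = r + relLength Z (fiberKernel 𝔄 Y n) := by rw [← e2, add_zero]
      exact (ENat.add_right_injective_of_ne_top (ENat.natCast_ne_top r) this).symm
    exact relLength_eq_zero.1 e4 ⟨hy, hby⟩
  refine ⟨max n₁ n₂, fun n hn k => ?_⟩
  induction k with
  | zero => intro y _ h; simpa using h
  | succ k ih =>
    intro y hy hk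
    refine ih y hy (step (n + k) (by omega) _ ?_ ?_)
    · have := pow_smul_mem_filtration Y (Ideal.pow_mem_pow hb k) hy
      rwa [add_right_comm] at this
    · rw [smul_smul, ← pow_succ']
      exact hk

/-- Enlarging a filtration by something killed by a form not vanishing at `p` does not change
the multiplicity at `p`. -/
lemma HasFiberLength.of_form_smul_le (h : IsCoord g 𝔄 b p) (hg : Ideal.span (Set.range g) = I)
    {Y Y' : I.Filtration M} (hY : shiftFiltration I M ≤ Y) (hYY' : Y ≤ Y') (hs : Y.Stable)
    (hs' : Y'.Stable) {r : ℕ} (hr : HasFiberLength 𝔄 Y r) {t : MvPolynomial ι R} {e : ℕ}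
    (ht : t.IsHomogeneous e) (hu : IsUnit (t.eval p))
    (htY : ∀ n, ∀ y ∈ Y'.N n, t.eval g • y ∈ Y.N (n + e)) :
    HasFiberLength 𝔄 Y' r := by
  have hA : 𝔄 ≤ I := hg ▸ h.le_span
  obtain ⟨u, hu⟩ := hu
  have hw := h.eval_sub_mem ht (𝔠 := ⊤) (fun _ => trivial)
  rw [Ideal.top_mul, hg, ← hu] at hw
  have hb : ∀ y : M, b ^ e • y = (↑u⁻¹ : R) • (t.eval g • y - (t.eval g - u * b ^ e) • y) := by
    intro y
    rw [← sub_smul, smul_smul, sub_sub_cancel, Units.inv_mul_cancel_left]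
  have hwY : ∀ n, ∀ y ∈ Y'.N (n + 1), (t.eval g - u * b ^ e) • y ∈ 𝔄 • Y'.N (n + e) := by
    intro n y hy
    exact smul_mono_right 𝔄 (Y'.antitone (by omega))
      (mul_smul_mem_smul_filtration Y' hw hy)
  have hwY' : ∀ n, ∀ y ∈ Y.N (n + 1), (t.eval g - u * b ^ e) • y ∈ 𝔄 • Y.N (n + e) := by
    intro n y hy
    exact smul_mono_right 𝔄 (Y.antitone (by omega))
      (mul_smul_mem_smul_filtration Y hw hy)
  obtain ⟨n₁, h₁⟩ := h.filtration_le hg hs'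
  obtain ⟨n₂, h₂⟩ := hr.injective h hg hY hs
  obtain ⟨n₃, h₃⟩ := hr
  refine ⟨max n₁ (max n₂ n₃) + e, fun n hn => ?_⟩
  have α : Y'.N (n + 1) = Y.N (n + 1) ⊔ fiberKernel 𝔄 Y' n := by
    refine le_antisymm ?_ (sup_le (hYY' _) (fiberKernel_le hA (hY.trans hYY') n))
    obtain ⟨m, rfl⟩ : ∃ m, n = m + e := ⟨n - e, by omega⟩
    have := h₁ m (by omega) e
    rw [add_right_comm] at this
    refine this.trans (sup_le ?_ (le_sup_of_le_right le_sup_left))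
    rintro _ ⟨y, hy, rfl⟩
    rw [LinearMap.lsmul_apply, hb]
    refine Submodule.smul_mem _ _ (sub_mem ?_ ?_)
    · refine Submodule.mem_sup_left ?_
      have := htY _ y hy
      rwa [add_right_comm] at this
    · exact Submodule.mem_sup_right (Submodule.mem_sup_left (hwY m y hy))
  have β : Y.N (n + 1) ⊓ fiberKernel 𝔄 Y' n = Y.N (n + 1) ⊓ fiberKernel 𝔄 Y n := by
    refine le_antisymm ?_ (inf_le_inf_left _ (fiberKernel_mono hYY' n))
    rintro y ⟨hy, hy'⟩
    refine ⟨hy, h₂ n (by omega) e y hy ?_⟩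
    rw [hb]
    refine Submodule.smul_mem _ _ (sub_mem ?_ (Submodule.mem_sup_left (hwY' n y hy)))
    obtain ⟨v, hv, z, hz, rfl⟩ := Submodule.mem_sup.1 hy'
    rw [smul_add]
    refine Submodule.add_mem_sup ?_ ?_
    · refine Submodule.smul_induction_on hv ?_ ?_
      · intro a ha y hy
        rw [smul_comm]
        exact Submodule.smul_mem_smul ha (htY n y hy)
      · intro y z hy hz
        rw [smul_add]
        exact add_mem hy hz
    · have : t.eval g ∈ I ^ e := by
        rw [← hg, Ideal.mem_span_pow_iff_exists_isHomogeneous]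
        exact ⟨t, ht, rfl⟩
      have := pow_smul_mem_filtration _ this hz
      rwa [add_right_comm] at this
  change relLength (Y'.N (n + 1)) (fiberKernel 𝔄 Y' n) = r
  rw [α, relLength_sup, ← relLength_inf, β, relLength_inf]
  exact h₃ n (by omega)

lemma IsTorFree.of_form_smul_le (h : IsCoord g 𝔄 b p) (hg : Ideal.span (Set.range g) = I)
    {Y Y' : I.Filtration M} (hr : IsTorFree 𝔄 b Y) {t : MvPolynomial ι R} {e : ℕ}
    (ht : t.IsHomogeneous e) (hu : IsUnit (t.eval p))
    (htY : ∀ n, ∀ y ∈ Y'.N n, t.eval g • y ∈ Y.N (n + e)) :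
    IsTorFree 𝔄 b Y' := by
  obtain ⟨E, hE⟩ := hr
  obtain ⟨u, hu⟩ := hu
  have hbI : b ∈ I := hg ▸ h.mem_span
  have hw := h.eval_sub_mem ht (𝔠 := ⊤) (fun _ => trivial)
  rw [Ideal.top_mul, hg, ← hu] at hw
  have htI : t.eval g ∈ I ^ e := by
    rw [← hg, Ideal.mem_span_pow_iff_exists_isHomogeneous]
    exact ⟨t, ht, rfl⟩
  refine ⟨e + E, fun n w hwY hwJ => ?_⟩
  have hb : b ^ (e + E) • w = (↑u⁻¹ : R) •
      (b ^ E • t.eval g • w - b ^ E • (t.eval g - u * b ^ e) • w) := by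
    rw [← smul_sub, ← sub_smul, sub_sub_cancel, smul_smul, smul_smul]
    congr 1
    linear_combination (-b ^ (e + E)) * u.inv_mul
  rw [hb]
  refine Submodule.smul_mem _ _ (sub_mem ?_ ?_)
  · have := hE (n + e) (t.eval g • w) ?_ ?_
    · rwa [add_assoc] at this
    · refine Submodule.smul_induction_on hwY ?_ ?_
      · intro a ha y hy
        rw [smul_comm]
        exact Submodule.smul_mem_smul ha (htY n y hy)
      · intro y z hy hz
        rw [smul_add]
        exact add_mem hy hz
    · have := pow_smul_mem_filtration _ htI hwJ
      rwa [add_right_comm] at this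
  · rw [← add_assoc]
    refine pow_smul_mem_smul_filtration _ (Ideal.pow_mem_pow hbI E) ?_
    exact smul_mono_right 𝔄 (Ideal.Filtration.antitone _ (by omega))
      (mul_smul_mem_smul_filtration _ hw hwJ)

end FiberMultiplicity

/-- The filtration generated by the element `x` placed in degree `n₀`. -/
def cyclicFiltration {R M : Type*} [CommRing R] [AddCommGroup M] [Module R M] (I : Ideal R)
    (x : M) (n₀ : ℕ) : I.Filtration M where
  N i := I ^ (i - n₀) • Submodule.span R {x}
  mono i := Submodule.smul_mono_left (Ideal.pow_le_pow_right (by omega))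
  smul_le i := by
    rw [← mul_smul, ← pow_succ']
    exact Submodule.smul_mono_left (Ideal.pow_le_pow_right (by omega))

/-- `x`, placed in degree `n₀`, spans modulo `Y` a free module over the fiber ring: a form with
coefficients outside `𝔪` does not multiply `x` into `Y`. -/
def IsFreeElt {R M ι : Type*} [CommRing R] [AddCommGroup M] [Module R M] {I : Ideal R}
    (𝔪 : Ideal R) (g : ι → R) (Y : I.Filtration M) (x : M) (n₀ : ℕ) : Prop :=
  ∀ (j : ℕ) (F : MvPolynomial ι R), F.IsHomogeneous j → F.eval g • x ∈ Y.N (n₀ + j) →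
    ∀ m, F.coeff m ∈ 𝔪

section FreeElements

variable {R M ι : Type*} [CommRing R] [AddCommGroup M] [Module R M] {I : Ideal R}
  {g : ι → R} {𝔄 : Ideal R} {b : R} {p : ι → R} {Y : I.Filtration M} {x : M} {n₀ : ℕ}

lemma sup_cyclicFiltration_of_lt (hY : shiftFiltration I M ≤ Y)
    (hx : x ∈ (I ^ n₀ • ⊤ : Submodule R M)) {n : ℕ} (hn : n < n₀) :
    (Y ⊔ cyclicFiltration I x n₀).N n = Y.N n := by
  rw [Ideal.Filtration.sup_N]
  refine sup_eq_left.2 (Submodule.smul_le_right.trans ?_)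
  rw [Submodule.span_singleton_le_iff_mem]
  exact hY n (Submodule.smul_mono_left (Ideal.pow_le_pow_right (by omega)) hx)

lemma sup_cyclicFiltration_add (j : ℕ) :
    (Y ⊔ cyclicFiltration I x n₀).N (n₀ + j) =
      Y.N (n₀ + j) ⊔ I ^ j • Submodule.span R {x} := by
  rw [Ideal.Filtration.sup_N]
  simp [cyclicFiltration]

lemma cyclicFiltration_le {F : I.Filtration M} (hx : x ∈ F.N n₀) :
    cyclicFiltration I x n₀ ≤ F := by
  intro n
  have h1 : Submodule.span R {x} ≤ F.N n₀ := by rwa [Submodule.span_singleton_le_iff_mem]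
  rcases le_or_gt n₀ n with h | h
  · refine (smul_mono_right _ h1).trans ((F.pow_smul_le _ _).trans_eq ?_)
    rw [Nat.sub_add_cancel h]
  · exact Submodule.smul_le_right.trans (h1.trans (F.antitone h.le))

namespace IsFreeElt

variable {𝔪 : Ideal R}

lemma smul_mem_smul (hfree : IsFreeElt 𝔪 g Y x n₀) (h : IsCoord g 𝔄 b p)
    (hg : Ideal.span (Set.range g) = I) (hm : ∀ c ∈ 𝔪, c • x ∈ Y.N n₀) {j : ℕ} {c : R}
    (hc : c ∈ 𝔄 * I ^ j) (hcx : c • x ∈ Y.N (n₀ + j + 1)) : c • x ∈ 𝔄 • Y.N (n₀ + j) := by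
  rw [← hg] at hc
  obtain ⟨F, hF, hFg, hFp⟩ := h.exists_form_of_mem_mul hc
  have hF' := hfree (j + 1) F hF (by rwa [hFg])
  have hc' := h.eval_sub_mem hF hF'
  rw [hFp, zero_mul, sub_zero, Nat.add_sub_cancel, hg, hFg, mul_comm] at hc'
  refine Submodule.mul_induction_on hc' ?_ ?_
  · intro a ha m hm'
    rw [mul_smul]
    exact mul_smul_mem_smul_filtration Y ha (hm m hm')
  · intro a a' ha ha'
    rw [add_smul]
    exact add_mem ha ha'

lemma smul_notMem (hfree : IsFreeElt 𝔪 g Y x n₀) (h : IsCoord g 𝔄 b p)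
    (hg : Ideal.span (Set.range g) = I) (h𝔪 : 𝔪 ≠ ⊤) (j : ℕ) :
    b ^ (j + 1) • x ∉ Y.N (n₀ + j + 1) ⊔ (𝔄 * I ^ j) • Submodule.span R {x} := by
  intro hmem
  obtain ⟨y, hy, z, hz, hyz⟩ := Submodule.mem_sup.1 hmem
  obtain ⟨c, hc, rfl⟩ := Submodule.mem_smul_span_singleton.1 hz
  rw [← hg] at hc
  obtain ⟨F, hF, hFg, hFp⟩ := h.exists_form_of_mem_mul hc
  obtain ⟨B, hB, hBg, hBp⟩ := h.exists_unit_form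
  have hB' := (hB.pow (j + 1)).sub (by rwa [one_mul])
  have h1 := hfree _ _ hB' (by
    rw [one_mul, map_sub, map_pow, hBg, hFg, sub_smul, ← hyz, add_sub_cancel_right]
    exact hy)
  refine h𝔪 ((Ideal.eq_top_iff_one _).2 ?_)
  have h2 : (B ^ (j + 1) - F).eval p = 1 := by simp [hBp, hFp]
  rw [← h2, MvPolynomial.eval_eq]
  exact sum_mem fun m _ => Ideal.mul_mem_right _ _ (h1 m)

lemma isTorFree_sup (hfree : IsFreeElt 𝔪 g Y x n₀) (h : IsCoord g 𝔄 b p)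
    (hg : Ideal.span (Set.range g) = I) (hm : ∀ c ∈ 𝔪, c • x ∈ Y.N n₀)
    (hY : shiftFiltration I M ≤ Y) (hx : x ∈ (I ^ n₀ • ⊤ : Submodule R M))
    (htor : IsTorFree 𝔄 b Y) : IsTorFree 𝔄 b (Y ⊔ cyclicFiltration I x n₀) := by
  obtain ⟨E, hE⟩ := htor
  refine ⟨E, fun n w hw hwJ => hE n w ?_ hwJ⟩
  rcases lt_or_ge n n₀ with hn | hn
  · rwa [sup_cyclicFiltration_of_lt hY hx hn] at hw
  · obtain ⟨j, rfl⟩ := Nat.exists_eq_add_of_le hn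
    rw [sup_cyclicFiltration_add, Submodule.smul_sup, ← mul_smul] at hw
    obtain ⟨y, hy, z, hz, rfl⟩ := Submodule.mem_sup.1 hw
    obtain ⟨c, hc, rfl⟩ := Submodule.mem_smul_span_singleton.1 hz
    refine add_mem hy (hfree.smul_mem_smul h hg hm hc ?_)
    have := sub_mem (hY _ hwJ) (smul_filtration_le (hg ▸ h.le_span) Y _ hy)
    rwa [add_sub_cancel_left] at this

lemma hasFiberLength_sup [IsLocalRing R] (hfree : IsFreeElt (IsLocalRing.maximalIdeal R) g Y x n₀)
    (h : IsCoord g 𝔄 b p) (hg : Ideal.span (Set.range g) = I)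
    (hm : ∀ c ∈ IsLocalRing.maximalIdeal R, c • x ∈ Y.N n₀)
    (hY : shiftFiltration I M ≤ Y) {r : ℕ} (hr : HasFiberLength 𝔄 Y r) :
    HasFiberLength 𝔄 (Y ⊔ cyclicFiltration I x n₀) (r + 1) := by
  have hA : 𝔄 ≤ I := hg ▸ h.le_span
  have hb : b ∈ I := hg ▸ h.mem_span
  obtain ⟨n₁, h₁⟩ := hr
  refine ⟨max n₀ n₁, fun n hn => ?_⟩
  obtain ⟨j, rfl⟩ := Nat.exists_eq_add_of_le (show n₀ ≤ n by omega)
  set Y' := Y ⊔ cyclicFiltration I x n₀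
  have hYY' : Y ≤ Y' := le_sup_left
  change relLength (Y'.N (n₀ + j + 1)) (fiberKernel 𝔄 Y' (n₀ + j)) = _
  have hker : fiberKernel 𝔄 Y' (n₀ + j) =
      fiberKernel 𝔄 Y (n₀ + j) ⊔ (𝔄 * I ^ j) • Submodule.span R {x} := by
    unfold fiberKernel
    rw [sup_cyclicFiltration_add, Submodule.smul_sup, ← mul_smul, sup_right_comm]
  have hinf : Y.N (n₀ + j + 1) ⊓ fiberKernel 𝔄 Y' (n₀ + j) = fiberKernel 𝔄 Y (n₀ + j) := by
    refine le_antisymm ?_ (le_inf (fiberKernel_le hA hY _) (fiberKernel_mono hYY' _))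
    rintro w ⟨hw, hw'⟩
    rw [SetLike.mem_coe, hker] at hw'
    obtain ⟨y, hy, z, hz, rfl⟩ := Submodule.mem_sup.1 hw'
    obtain ⟨c, hc, rfl⟩ := Submodule.mem_smul_span_singleton.1 hz
    refine add_mem hy (Submodule.mem_sup_left (hfree.smul_mem_smul h hg hm hc ?_))
    have := sub_mem hw (fiberKernel_le hA hY _ hy)
    rwa [add_sub_cancel_left] at this
  have hZ : Y.N (n₀ + j + 1) ⊔ fiberKernel 𝔄 Y' (n₀ + j) =
      Y.N (n₀ + j + 1) ⊔ (𝔄 * I ^ j) • Submodule.span R {x} := by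
    rw [hker, ← sup_assoc, sup_eq_left.2 (fiberKernel_le hA hY _)]
  have htop : Y'.N (n₀ + j + 1) = Submodule.span R {b ^ (j + 1) • x} ⊔
      (Y.N (n₀ + j + 1) ⊔ fiberKernel 𝔄 Y' (n₀ + j)) := by
    have h2 : Y'.N (n₀ + j + 1) = Y.N (n₀ + j + 1) ⊔ I ^ (j + 1) • Submodule.span R {x} :=
      sup_cyclicFiltration_add (j + 1)
    refine le_antisymm ?_ (sup_le ?_ (sup_le (hYY' _) (fiberKernel_le hA (hY.trans hYY') _)))
    · rw [h2, hZ]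
      refine sup_le (le_sup_of_le_right le_sup_left) ?_
      have h3 := h.span_pow_succ_le j
      rw [hg] at h3
      refine (Submodule.smul_mono_left h3).trans ?_
      rw [Submodule.sup_smul, Submodule.ideal_span_singleton_smul, Submodule.smul_span,
        Set.smul_set_singleton]
      exact sup_le_sup_left le_sup_right _
    · rw [Submodule.span_singleton_le_iff_mem, h2]
      exact Submodule.mem_sup_right (Submodule.smul_mem_smul (Ideal.pow_mem_pow hb _)
        (Submodule.mem_span_singleton_self x))
  have hstep := relLength_add (le_sup_right :
      fiberKernel 𝔄 Y' (n₀ + j) ≤ Y.N (n₀ + j + 1) ⊔ fiberKernel 𝔄 Y' (n₀ + j))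
    (htop ▸ le_sup_right :
      Y.N (n₀ + j + 1) ⊔ fiberKernel 𝔄 Y' (n₀ + j) ≤ Y'.N (n₀ + j + 1))
  have hone : relLength (Y'.N (n₀ + j + 1))
      (Y.N (n₀ + j + 1) ⊔ fiberKernel 𝔄 Y' (n₀ + j)) = 1 := by
    rw [htop, relLength_sup]
    refine relLength_span_singleton ?_ fun c hc => ?_
    · rw [hZ]
      exact hfree.smul_notMem h hg (IsLocalRing.maximalIdeal.isMaximal R).ne_top j
    · rw [smul_comm]
      exact Submodule.mem_sup_left
        (pow_smul_mem_filtration Y (Ideal.pow_mem_pow hb (j + 1)) (hm c hc))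
  rw [hstep, hone, relLength_sup, ← relLength_inf, hinf, add_comm,
    show relLength (Y.N (n₀ + j + 1)) (fiberKernel 𝔄 Y (n₀ + j)) = r from h₁ _ (by omega)]
  rfl

end IsFreeElt

end FreeElements

/-- The polynomials with coefficients in `𝔪`. -/
def residueKer {R : Type*} [CommRing R] (𝔪 : Ideal R) (ι : Type*) : Ideal (MvPolynomial ι R) :=
  RingHom.ker (MvPolynomial.map (Ideal.Quotient.mk 𝔪))

section ResidueKer

variable {R M ι : Type*} [CommRing R] {𝔪 : Ideal R}

lemma mem_residueKer {F : MvPolynomial ι R} : F ∈ residueKer 𝔪 ι ↔ ∀ m, F.coeff m ∈ 𝔪 := by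
  rw [residueKer, RingHom.mem_ker, MvPolynomial.ext_iff]
  simp [MvPolynomial.coeff_map, Ideal.Quotient.eq_zero_iff_mem]

instance [𝔪.IsPrime] : (residueKer 𝔪 ι).IsPrime := RingHom.ker_isPrime _

lemma relLength_homogeneousSubmodule [𝔪.IsMaximal] (q j : ℕ) :
    relLength (MvPolynomial.homogeneousSubmodule (Fin (q + 1)) R j)
      ((residueKer 𝔪 (Fin (q + 1))).restrictScalars R) = (j + q).choose q := by
  set T := Finset.finsuppAntidiag (Finset.univ : Finset (Fin (q + 1))) j with hT
  have hmemT : ∀ m, m ∈ T ↔ m.degree = j := by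
    intro m
    rw [hT, Finset.mem_finsuppAntidiag]
    simp [Finsupp.degree_eq_sum]
  let c : MvPolynomial (Fin (q + 1)) R →ₗ[R] (T → R ⧸ 𝔪) :=
    LinearMap.pi fun m => (Submodule.mkQ 𝔪) ∘ₗ MvPolynomial.lcoeff R (m : Fin (q + 1) →₀ ℕ)
  have h1 : MvPolynomial.homogeneousSubmodule (Fin (q + 1)) R j ⊓
      (residueKer 𝔪 (Fin (q + 1))).restrictScalars R =
      MvPolynomial.homogeneousSubmodule (Fin (q + 1)) R j ⊓ (⊥ : Submodule R _).comap c := by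
    ext F
    simp only [Submodule.mem_inf, Submodule.restrictScalars_mem, mem_residueKer,
      Submodule.mem_comap, Submodule.mem_bot, MvPolynomial.mem_homogeneousSubmodule]
    refine and_congr_right fun hF => ⟨fun h => ?_, fun h m => ?_⟩
    · ext m
      simpa [c, Ideal.Quotient.eq_zero_iff_mem] using h m
    · by_cases hm : m ∈ T
      · have := congr_fun h ⟨m, hm⟩
        simpa [c, Ideal.Quotient.eq_zero_iff_mem] using this
      · rw [hF.coeff_eq_zero (mt (hmemT m).2 hm)]
        exact 𝔪.zero_mem
  have h2 : (MvPolynomial.homogeneousSubmodule (Fin (q + 1)) R j).map c = ⊤ := by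
    rw [eq_top_iff]
    intro v _
    choose w hw using fun m => Ideal.Quotient.mk_surjective (v m)
    refine ⟨∑ m : T, MvPolynomial.monomial (m : Fin (q + 1) →₀ ℕ) (w m), ?_, ?_⟩
    · refine Submodule.sum_mem _ fun m _ => ?_
      exact MvPolynomial.isHomogeneous_monomial _ ((hmemT _).1 m.2)
    · ext m
      simp only [c, LinearMap.pi_apply, LinearMap.comp_apply, MvPolynomial.lcoeff_apply,
        MvPolynomial.coeff_sum, MvPolynomial.coeff_monomial, Subtype.coe_inj, Finset.sum_ite_eq',
        Finset.mem_univ, if_true]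
      exact hw m
  rw [← relLength_inf, h1, relLength_inf, relLength_comap, h2, relLength_top,
    (Submodule.quotEquivOfEqBot ⊥ rfl).length_eq, Module.length_pi_of_fintype]
  have : IsSimpleModule R (R ⧸ 𝔪) := isSimpleModule_iff_isCoatom.2 (Ideal.isMaximal_def.1 ‹_›)
  simp only [Module.length_eq_one, Finset.sum_const, Finset.card_univ, Fintype.card_coe, hT,
    Finset.card_finsuppAntidiag_nat_eq_choose, Fintype.card_fin, nsmul_eq_mul, mul_one]
  rw [show q + 1 + j - 1 = j + q by omega, Nat.choose_symm_add]

end ResidueKer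

lemma tendsto_choose_sub (q n₀ : ℕ) :
    Tendsto (fun n : ℕ => (q.factorial : ℝ) / (n : ℝ) ^ q * ((n - n₀ + q).choose q : ℕ))
      atTop (nhds 1) := by
  have h1 : Tendsto (fun n : ℕ => (q.factorial : ℝ) / (n : ℝ) ^ q * (n.choose q : ℕ))
      atTop (nhds 1) := by
    have := (isEquivalent_choose q)
    rw [Asymptotics.isEquivalent_iff_tendsto_one] at this
    · refine this.congr fun n => ?_
      simp only [Pi.div_apply]
      field_simp
    · filter_upwards [eventually_gt_atTop 0] with n hn
      positivity
  have h2 : Tendsto (fun n : ℕ => n - n₀ + q) atTop atTop :=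
    (tendsto_add_atTop_nat q).comp (tendsto_sub_atTop_nat n₀)
  have h3 : Tendsto (fun n : ℕ => ((n - n₀ + q : ℕ) : ℝ) ^ q / (n : ℝ) ^ q) atTop (nhds 1) := by
    have h4 : Tendsto (fun n : ℕ => 1 + ((q : ℝ) - n₀) / n) atTop (nhds (1 + 0)) :=
      tendsto_const_nhds.add (tendsto_const_div_atTop_nhds_zero_nat _)
    have h5 := h4.pow q
    rw [add_zero, one_pow] at h5
    refine h5.congr' ?_
    filter_upwards [eventually_gt_atTop 0, eventually_ge_atTop n₀] with n hn hn'
    rw [← div_pow]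
    congr 1
    push_cast [hn']
    field_simp
    ring
  have := (h1.comp h2).mul h3
  rw [one_mul] at this
  refine this.congr' ?_
  filter_upwards [eventually_gt_atTop 0, h2.eventually_gt_atTop 0] with n hn hn'
  simp only [Function.comp]
  field_simp

/-- The modules `Yₙ / I^(n+1) M` have finite length, asymptotic to `r n^q / q!`. -/
def HasHilbert {R M : Type*} [CommRing R] [AddCommGroup M] [Module R M] {I : Ideal R}
    (Y : I.Filtration M) (q r : ℕ) : Prop :=
  (∀ n, relLength (Y.N n) ((shiftFiltration I M).N n) ≠ ⊤) ∧
    Tendsto (fun n : ℕ => (q.factorial : ℝ) / (n : ℝ) ^ q *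
      ((relLength (Y.N n) ((shiftFiltration I M).N n)).toNat : ℝ)) atTop (nhds (r : ℝ))

section Hilbert

variable {R M : Type*} [CommRing R] [AddCommGroup M] [Module R M] {I : Ideal R} {q : ℕ}
  {g : Fin (q + 1) → R} {Y : I.Filtration M} {x : M} {n₀ : ℕ} {𝔪 : Ideal R}

/-- Evaluation of polynomials at `g`, times `x`. -/
def evalSmul {ι : Type*} (g : ι → R) (x : M) : MvPolynomial ι R →ₗ[R] M :=
  LinearMap.toSpanSingleton R M x ∘ₗ (MvPolynomial.aeval g).toLinearMap

lemma evalSmul_apply {ι : Type*} (g : ι → R) (x : M) (F : MvPolynomial ι R) :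
    evalSmul g x F = F.eval g • x := by
  simp [evalSmul, MvPolynomial.aeval_eq_eval]

lemma relLength_sup_cyclicFiltration (hg : Ideal.span (Set.range g) = I) (j : ℕ) :
    relLength ((Y ⊔ cyclicFiltration I x n₀).N (n₀ + j)) (Y.N (n₀ + j)) =
      relLength (MvPolynomial.homogeneousSubmodule (Fin (q + 1)) R j)
        ((Y.N (n₀ + j)).comap (evalSmul g x)) := by
  rw [sup_cyclicFiltration_add, sup_comm, relLength_sup, relLength_comap]
  congr 1
  ext z
  rw [Submodule.mem_smul_span_singleton, Submodule.mem_map]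
  constructor
  · rintro ⟨c, hc, rfl⟩
    rw [← hg, Ideal.mem_span_pow_iff_exists_isHomogeneous] at hc
    obtain ⟨F, hF, rfl⟩ := hc
    exact ⟨F, hF, evalSmul_apply _ _ _⟩
  · rintro ⟨F, hF, rfl⟩
    refine ⟨F.eval g, ?_, (evalSmul_apply _ _ _).symm⟩
    rw [← hg, Ideal.mem_span_pow_iff_exists_isHomogeneous]
    exact ⟨F, hF, rfl⟩

lemma eval_smul_mem_of_mem_residueKer (hg : Ideal.span (Set.range g) = I)
    (hm : ∀ c ∈ 𝔪, c • x ∈ Y.N n₀) {j : ℕ} {F : MvPolynomial (Fin (q + 1)) R}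
    (hF : F.IsHomogeneous j) (hF' : F ∈ residueKer 𝔪 (Fin (q + 1))) :
    F.eval g • x ∈ Y.N (n₀ + j) := by
  rw [MvPolynomial.eval_eq, Finset.sum_smul]
  refine sum_mem fun m hm' => ?_
  rw [mul_comm, mul_smul]
  refine pow_smul_mem_filtration Y ?_ (hm _ (mem_residueKer.1 hF' m))
  rw [← hg, Ideal.mem_span_pow_iff_exists_isHomogeneous]
  refine ⟨MvPolynomial.monomial m 1, MvPolynomial.isHomogeneous_monomial _ ?_, ?_⟩
  · by_contra hne
    exact MvPolynomial.mem_support_iff.1 hm' (hF.coeff_eq_zero hne)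
  · rw [MvPolynomial.eval_monomial, one_mul]
    rfl

lemma homogeneousSubmodule_inf_residueKer_le (hg : Ideal.span (Set.range g) = I)
    (hm : ∀ c ∈ 𝔪, c • x ∈ Y.N n₀) (j : ℕ) :
    MvPolynomial.homogeneousSubmodule (Fin (q + 1)) R j ⊓
      (residueKer 𝔪 (Fin (q + 1))).restrictScalars R ≤ (Y.N (n₀ + j)).comap (evalSmul g x) := by
  rintro F ⟨hF, hF'⟩
  rw [Submodule.mem_comap, evalSmul_apply]
  exact eval_smul_mem_of_mem_residueKer hg hm hF hF'

lemma IsFreeElt.relLength_eq [𝔪.IsMaximal] (hfree : IsFreeElt 𝔪 g Y x n₀)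
    (hg : Ideal.span (Set.range g) = I) (hm : ∀ c ∈ 𝔪, c • x ∈ Y.N n₀) (j : ℕ) :
    relLength ((Y ⊔ cyclicFiltration I x n₀).N (n₀ + j)) (Y.N (n₀ + j)) =
      (j + q).choose q := by
  rw [relLength_sup_cyclicFiltration hg, ← relLength_homogeneousSubmodule (𝔪 := 𝔪),
    ← relLength_inf, ← relLength_inf _ ((residueKer 𝔪 (Fin (q + 1))).restrictScalars R)]
  congr 1
  refine le_antisymm (fun F hF => ⟨hF.1, ?_⟩) (le_inf inf_le_left
    (homogeneousSubmodule_inf_residueKer_le hg hm j))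
  refine mem_residueKer.2 (hfree j F hF.1 ?_)
  rw [← evalSmul_apply]
  exact hF.2

lemma relLength_sup_cyclicFiltration_le [𝔪.IsMaximal]
    (hg : Ideal.span (Set.range g) = I) (hm : ∀ c ∈ 𝔪, c • x ∈ Y.N n₀) (j : ℕ) :
    relLength ((Y ⊔ cyclicFiltration I x n₀).N (n₀ + j)) (Y.N (n₀ + j)) ≤
      (j + q).choose q := by
  rw [relLength_sup_cyclicFiltration hg, ← relLength_homogeneousSubmodule (𝔪 := 𝔪),
    ← relLength_inf, ← relLength_inf _ ((residueKer 𝔪 (Fin (q + 1))).restrictScalars R),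
    relLength_add (le_inf inf_le_left (homogeneousSubmodule_inf_residueKer_le hg hm j))
      inf_le_left]
  exact le_self_add

lemma relLength_sup_cyclicFiltration_add_le [𝔪.IsMaximal]
    (hg : Ideal.span (Set.range g) = I) (hm : ∀ c ∈ 𝔪, c • x ∈ Y.N n₀)
    {t : MvPolynomial (Fin (q + 1)) R} {e : ℕ} (ht : t.IsHomogeneous e)
    (ht' : t ∉ residueKer 𝔪 (Fin (q + 1))) (htx : t.eval g • x ∈ Y.N (n₀ + e)) (j : ℕ) :
    relLength ((Y ⊔ cyclicFiltration I x n₀).N (n₀ + (e + j))) (Y.N (n₀ + (e + j))) +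
      (j + q).choose q ≤ (e + j + q).choose q := by
  set P := MvPolynomial.homogeneousSubmodule (Fin (q + 1)) R
  set K := (residueKer 𝔪 (Fin (q + 1))).restrictScalars R
  set C := P (e + j) ⊓ (Y.N (n₀ + (e + j))).comap (evalSmul g x)
  have hKC : P (e + j) ⊓ K ≤ C :=
    le_inf inf_le_left (homogeneousSubmodule_inf_residueKer_le hg hm _)
  have htP : (P j).map (LinearMap.mulLeft R t) ≤ C := by
    rintro _ ⟨F, hF, rfl⟩
    refine ⟨ht.mul hF, ?_⟩
    change evalSmul g x (t * F) ∈ Y.N (n₀ + (e + j))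
    rw [evalSmul_apply, map_mul, mul_comm, mul_smul, ← add_assoc]
    refine pow_smul_mem_filtration Y ?_ htx
    rw [← hg, Ideal.mem_span_pow_iff_exists_isHomogeneous]
    exact ⟨F, hF, rfl⟩
  have hjj : relLength (P j) K = relLength ((P j).map (LinearMap.mulLeft R t)) (P (e + j) ⊓ K) := by
    rw [← relLength_comap, ← relLength_inf, ← relLength_inf _ ((P (e + j) ⊓ K).comap _)]
    congr 1
    ext F
    refine and_congr_right fun hF => ?_
    change F ∈ residueKer 𝔪 _ ↔ t * F ∈ P (e + j) ∧ t * F ∈ residueKer 𝔪 _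
    rw [Ideal.IsPrime.mul_mem_iff_mem_or_mem (I := residueKer 𝔪 (Fin (q + 1))) inferInstance]
    exact ⟨fun h => ⟨ht.mul hF, Or.inr h⟩, fun h => h.2.resolve_left ht'⟩
  have hj : relLength (P j) K = _ := relLength_homogeneousSubmodule (𝔪 := 𝔪) q j
  have hej : relLength (P (e + j)) K = _ := relLength_homogeneousSubmodule (𝔪 := 𝔪) q (e + j)
  rw [relLength_sup_cyclicFiltration hg, ← hj, ← hej, ← relLength_inf _ (Submodule.comap _ _),
    ← relLength_inf (P (e + j)) K, relLength_add hKC inf_le_left, hjj]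
  exact add_le_add_right (relLength_mono htP) _

lemma relLength_sup_cyclicFiltration_of_lt (hY : shiftFiltration I M ≤ Y)
    (hx : x ∈ (I ^ n₀ • ⊤ : Submodule R M)) {n : ℕ} (hn : n < n₀) :
    relLength ((Y ⊔ cyclicFiltration I x n₀).N n) (Y.N n) = 0 := by
  rw [relLength_eq_zero, sup_cyclicFiltration_of_lt hY hx hn]

lemma HasHilbert.of_tendsto {r s : ℕ} (h : HasHilbert Y q r) {Y' : I.Filtration M}
    (hY : shiftFiltration I M ≤ Y) (hYY' : Y ≤ Y')
    (hfin : ∀ n, relLength (Y'.N n) (Y.N n) ≠ ⊤)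
    (hlim : Tendsto (fun n : ℕ => (q.factorial : ℝ) / (n : ℝ) ^ q *
      ((relLength (Y'.N n) (Y.N n)).toNat : ℝ)) atTop (nhds (s : ℝ))) :
    HasHilbert Y' q (r + s) := by
  have key : ∀ n, relLength (Y'.N n) ((shiftFiltration I M).N n) =
      relLength (Y'.N n) (Y.N n) + relLength (Y.N n) ((shiftFiltration I M).N n) :=
    fun n => relLength_add (hY n) (hYY' n)
  refine ⟨fun n => ?_, ?_⟩
  · rw [key]
    exact WithTop.add_ne_top.2 ⟨hfin n, h.1 n⟩
  · have := h.2.add hlim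
    rw [Nat.cast_add]
    refine this.congr fun n => ?_
    rw [key, ENat.toNat_add (hfin n) (h.1 n)]
    push_cast
    ring

lemma relLength_sup_cyclicFiltration_ne_top [𝔪.IsMaximal] (hg : Ideal.span (Set.range g) = I)
    (hY : shiftFiltration I M ≤ Y)
    (hx : x ∈ (I ^ n₀ • ⊤ : Submodule R M)) (hm : ∀ c ∈ 𝔪, c • x ∈ Y.N n₀) (n : ℕ) :
    relLength ((Y ⊔ cyclicFiltration I x n₀).N n) (Y.N n) ≠ ⊤ := by
  rcases lt_or_ge n n₀ with hn | hn
  · rw [relLength_sup_cyclicFiltration_of_lt hY hx hn]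
    exact ENat.zero_ne_top
  · obtain ⟨j, rfl⟩ := Nat.exists_eq_add_of_le hn
    exact ne_top_of_le_ne_top (ENat.natCast_ne_top _)
      (relLength_sup_cyclicFiltration_le hg hm j)

lemma HasHilbert.sup_of_isFreeElt [𝔪.IsMaximal] {r : ℕ} (h : HasHilbert Y q r)
    (hfree : IsFreeElt 𝔪 g Y x n₀)
    (hg : Ideal.span (Set.range g) = I) (hY : shiftFiltration I M ≤ Y)
    (hx : x ∈ (I ^ n₀ • ⊤ : Submodule R M)) (hm : ∀ c ∈ 𝔪, c • x ∈ Y.N n₀) :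
    HasHilbert (Y ⊔ cyclicFiltration I x n₀) q (r + 1) := by
  refine h.of_tendsto hY le_sup_left (relLength_sup_cyclicFiltration_ne_top hg hY hx hm) ?_
  rw [Nat.cast_one]
  refine (tendsto_choose_sub q n₀).congr' ?_
  filter_upwards [eventually_ge_atTop n₀] with n hn
  obtain ⟨j, rfl⟩ := Nat.exists_eq_add_of_le hn
  rw [hfree.relLength_eq hg hm, ENat.toNat_natCast, Nat.add_sub_cancel_left]

lemma HasHilbert.sup_of_eval_smul_mem [𝔪.IsMaximal] {r : ℕ} (h : HasHilbert Y q r)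
    (hg : Ideal.span (Set.range g) = I) (hY : shiftFiltration I M ≤ Y)
    (hx : x ∈ (I ^ n₀ • ⊤ : Submodule R M)) (hm : ∀ c ∈ 𝔪, c • x ∈ Y.N n₀)
    {t : MvPolynomial (Fin (q + 1)) R} {e : ℕ} (ht : t.IsHomogeneous e)
    (ht' : t ∉ residueKer 𝔪 (Fin (q + 1))) (htx : t.eval g • x ∈ Y.N (n₀ + e)) :
    HasHilbert (Y ⊔ cyclicFiltration I x n₀) q r := by
  have hfin := relLength_sup_cyclicFiltration_ne_top hg hY hx hm
  refine h.of_tendsto (s := 0) hY le_sup_left hfin ?_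
  rw [Nat.cast_zero]
  have h1 := (tendsto_choose_sub q n₀).sub (tendsto_choose_sub q (n₀ + e))
  rw [sub_self] at h1
  refine squeeze_zero' (Eventually.of_forall fun n => by positivity) ?_ h1
  filter_upwards [eventually_ge_atTop (n₀ + e)] with n hn
  obtain ⟨j, rfl⟩ := Nat.exists_eq_add_of_le hn
  have h2 := relLength_sup_cyclicFiltration_add_le hg hm ht ht' htx j
  rw [← add_assoc, ← ENat.natCast_toNat (hfin (n₀ + e + j))] at h2
  norm_cast at h2
  rw [show n₀ + e + j - n₀ = e + j by omega, Nat.add_sub_cancel_left, ← mul_sub]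
  refine mul_le_mul_of_nonneg_left ?_ (by positivity)
  rw [le_sub_iff_add_le]
  exact_mod_cast h2

lemma hasHilbert_shiftFiltration (q : ℕ) : HasHilbert (shiftFiltration I M) q 0 := by
  have : ∀ n, relLength ((shiftFiltration I M).N n) ((shiftFiltration I M).N n) = 0 :=
    fun n => relLength_eq_zero.2 le_rfl
  refine ⟨fun n => by simp [this], ?_⟩
  simp [this]

end Hilbert

lemma Ideal.Filtration.Stable.exists_maximal_of_le {R M : Type*} [CommRing R] [IsNoetherianRing R]
    [AddCommGroup M] [Module R M] [Module.Finite R M] {I : Ideal R} {G : I.Filtration M}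
    (hG : G.Stable) {S : Set (I.Filtration M)} (hS : S.Nonempty) (hle : ∀ Y ∈ S, Y ≤ G) :
    ∃ Y ∈ S, ∀ Y' ∈ S, Y ≤ Y' → Y' ≤ Y := by
  have hfg := (Ideal.Filtration.submodule_fg_iff_stable G
    (fun i => IsNoetherian.noetherian _)).2 hG
  have := isNoetherian_of_fg_of_noetherian _ hfg
  let f : I.Filtration M → Submodule (reesAlgebra I) G.submodule :=
    fun Y => Y.submodule.comap G.submodule.subtype
  have wf : WellFounded (InvImage (· > ·) f) := InvImage.wf f wellFounded_gt
  obtain ⟨Y, hY, hmin⟩ := wf.has_min S hS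
  refine ⟨Y, hY, fun Y' hY' hYY' => ?_⟩
  have h1 : f Y ≤ f Y' := fun z hz i => hYY' i (hz i)
  have h2 : f Y' ≤ f Y := by
    by_contra hne
    exact hmin Y' hY' (lt_of_le_not_ge h1 hne)
  intro i y hy
  have key : ∀ (F : I.Filtration M), y ∈ F.N i →
      PolynomialModule.single R i y ∈ F.submodule := by
    intro F hF j
    rw [PolynomialModule.coeff_single, Finsupp.single_apply]
    split_ifs with hij
    · rwa [← hij]
    · exact zero_mem _
  have h3 : (⟨PolynomialModule.single R i y, key G (hle Y' hY' i hy)⟩ : G.submodule) ∈ f Y' :=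
    key Y' hy
  have h4 := h2 h3 i
  simpa using h4

/-- The filtration by the elements of `IⁿM` killed by a power of `𝔪` modulo `I^(n+1) M`. -/
def h0Filtration {R : Type*} [CommRing R] (𝔪 I : Ideal R) (M : Type*) [AddCommGroup M]
    [Module R M] : I.Filtration M where
  N i :=
    { carrier := {x | x ∈ (I ^ i • ⊤ : Submodule R M) ∧
        ∃ k, ∀ c ∈ 𝔪 ^ k, c • x ∈ (I ^ (i + 1) • ⊤ : Submodule R M)}
      add_mem' := by
        rintro x y ⟨hx, k, hk⟩ ⟨hy, l, hl⟩
        refine ⟨add_mem hx hy, k + l, fun c hc => ?_⟩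
        rw [smul_add]
        exact add_mem (hk c (Ideal.pow_le_pow_right (by omega) hc))
          (hl c (Ideal.pow_le_pow_right (by omega) hc))
      zero_mem' := ⟨zero_mem _, 0, fun c _ => by simp⟩
      smul_mem' := by
        rintro r x ⟨hx, k, hk⟩
        refine ⟨Submodule.smul_mem _ _ hx, k, fun c hc => ?_⟩
        rw [smul_comm]
        exact Submodule.smul_mem _ _ (hk c hc) }
  mono i := by
    rintro x ⟨hx, k, hk⟩
    refine ⟨Submodule.smul_mono_left (Ideal.pow_le_pow_right (by omega)) hx, 0, fun c _ => ?_⟩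
    exact Submodule.smul_mem _ _ hx
  smul_le i := by
    rw [Submodule.smul_le]
    rintro r hr x ⟨hx, k, hk⟩
    refine ⟨?_, k, fun c hc => ?_⟩
    · rw [pow_succ', mul_smul]
      exact Submodule.smul_mem_smul hr hx
    · rw [smul_comm, pow_succ', mul_smul]
      exact Submodule.smul_mem_smul hr (hk c hc)

section Generic

variable {R M : Type*} [CommRing R] [AddCommGroup M] [Module R M] {𝔪 I : Ideal R}

lemma mem_h0Filtration {i : ℕ} {x : M} : x ∈ (h0Filtration 𝔪 I M).N i ↔
    x ∈ (I ^ i • ⊤ : Submodule R M) ∧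
      ∃ k, ∀ c ∈ 𝔪 ^ k, c • x ∈ (I ^ (i + 1) • ⊤ : Submodule R M) := Iff.rfl

lemma h0Filtration_le : h0Filtration 𝔪 I M ≤ I.stableFiltration ⊤ := fun _ _ h => h.1

lemma shiftFiltration_le_h0Filtration : shiftFiltration I M ≤ h0Filtration 𝔪 I M :=
  fun _ _ hx => ⟨Submodule.smul_mono_left (Ideal.pow_le_pow_right (by omega)) hx, 0,
    fun _ _ => Submodule.smul_mem _ _ hx⟩

/-- `Y / ⨁ I^(n+1) M` has multiplicity `r` as a graded module, and also locally at every
point outside a hypersurface. -/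
def IsGenericMultiplicity {q : ℕ} (𝔪 : Ideal R) (g : Fin (q + 1) → R) (Y : I.Filtration M)
    (r : ℕ) : Prop :=
  HasHilbert Y q r ∧ ∃ (t : MvPolynomial (Fin (q + 1)) R) (e : ℕ), t.IsHomogeneous e ∧
    t ∉ residueKer 𝔪 (Fin (q + 1)) ∧ ∀ 𝔄 b p, IsCoord g 𝔄 b p → IsUnit (t.eval p) →
      HasFiberLength 𝔄 Y r ∧ IsTorFree 𝔄 b Y

variable {q : ℕ} {g : Fin (q + 1) → R}

lemma isGenericMultiplicity_shiftFiltration [h𝔪 : 𝔪.IsPrime] :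
    IsGenericMultiplicity 𝔪 g (shiftFiltration I M) 0 := by
  refine ⟨hasHilbert_shiftFiltration q, 1, 0, MvPolynomial.isHomogeneous_one _ _,
    (Ideal.ne_top_iff_one _).1 (Ideal.IsPrime.ne_top inferInstance), fun 𝔄 b p _ _ => ⟨?_, ?_⟩⟩
  · exact ⟨0, fun n _ => relLength_eq_zero.2 le_sup_right⟩
  · exact ⟨0, fun n w hw _ => by simpa using hw⟩

lemma IsGenericMultiplicity.exists_sup [IsNoetherianRing R] [IsLocalRing R] [Module.Finite R M]
    {Y : I.Filtration M} {r : ℕ}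
    (h : IsGenericMultiplicity (IsLocalRing.maximalIdeal R) g Y r)
    (hg : Ideal.span (Set.range g) = I) (hY : shiftFiltration I M ≤ Y)
    (hYG : Y ≤ I.stableFiltration ⊤) {x : M} {n₀ : ℕ} (hx : x ∈ (I ^ n₀ • ⊤ : Submodule R M))
    (hm : ∀ c ∈ IsLocalRing.maximalIdeal R, c • x ∈ Y.N n₀) :
    ∃ r', IsGenericMultiplicity (IsLocalRing.maximalIdeal R) g
      (Y ⊔ cyclicFiltration I x n₀) r' := by
  have hs : Y.Stable := (I.stableFiltration_stable ⊤).of_le hYG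
  have hs' : (Y ⊔ cyclicFiltration I x n₀).Stable :=
    (I.stableFiltration_stable ⊤).of_le (sup_le hYG (cyclicFiltration_le hx))
  obtain ⟨hH, t, e, ht, ht', hloc⟩ := h
  by_cases hfree : IsFreeElt (IsLocalRing.maximalIdeal R) g Y x n₀
  · refine ⟨r + 1, hH.sup_of_isFreeElt hfree hg hY hx hm, t, e, ht, ht', fun 𝔄 b p hc hu => ?_⟩
    obtain ⟨h1, h2⟩ := hloc 𝔄 b p hc hu
    exact ⟨hfree.hasFiberLength_sup hc hg hm hY h1, hfree.isTorFree_sup hc hg hm hY hx h2⟩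
  · obtain ⟨j, F, hF, hFx, hF'⟩ : ∃ (j : ℕ) (F : MvPolynomial (Fin (q + 1)) R),
        F.IsHomogeneous j ∧ F.eval g • x ∈ Y.N (n₀ + j) ∧
          F ∉ residueKer (IsLocalRing.maximalIdeal R) (Fin (q + 1)) := by
      simpa [IsFreeElt, mem_residueKer] using hfree
    refine ⟨r, hH.sup_of_eval_smul_mem hg hY hx hm hF hF' hFx, t * F, e + j, ht.mul hF, ?_,
      fun 𝔄 b p hc hu => ?_⟩
    · exact fun hmem => (Ideal.IsPrime.mem_or_mem inferInstance hmem).elim ht' hF'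
    · rw [map_mul, IsUnit.mul_iff] at hu
      obtain ⟨h1, h2⟩ := hloc 𝔄 b p hc hu.1
      have hFI : F.eval g ∈ I ^ j := by
        rw [← hg, Ideal.mem_span_pow_iff_exists_isHomogeneous]
        exact ⟨F, hF, rfl⟩
      have hFY : ∀ n, ∀ y ∈ (Y ⊔ cyclicFiltration I x n₀).N n, F.eval g • y ∈ Y.N (n + j) := by
        intro n y hy
        rcases lt_or_ge n n₀ with hn | hn
        · rw [sup_cyclicFiltration_of_lt hY hx hn] at hy
          exact pow_smul_mem_filtration Y hFI hy
        · obtain ⟨i, rfl⟩ := Nat.exists_eq_add_of_le hn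
          rw [sup_cyclicFiltration_add] at hy
          obtain ⟨y, hy', z, hz, rfl⟩ := Submodule.mem_sup.1 hy
          obtain ⟨c, hc, rfl⟩ := Submodule.mem_smul_span_singleton.1 hz
          rw [smul_add]
          refine add_mem (pow_smul_mem_filtration Y hFI hy') ?_
          rw [smul_comm, add_right_comm]
          exact pow_smul_mem_filtration Y hc hFx
      exact ⟨h1.of_form_smul_le hc hg hY le_sup_left hs hs' hF hu.2 hFY,
        h2.of_form_smul_le hc hg hF hu.2 hFY⟩

lemma exists_isGenericMultiplicity_h0Filtration [IsNoetherianRing R] [IsLocalRing R]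
    [Module.Finite R M] (hg : Ideal.span (Set.range g) = I) :
    ∃ r, IsGenericMultiplicity (IsLocalRing.maximalIdeal R) g
      (h0Filtration (IsLocalRing.maximalIdeal R) I M) r := by
  set 𝔪 := IsLocalRing.maximalIdeal R
  set H := h0Filtration 𝔪 I M
  let S : Set (I.Filtration M) :=
    {Y | shiftFiltration I M ≤ Y ∧ Y ≤ H ∧ ∃ r, IsGenericMultiplicity 𝔪 g Y r}
  obtain ⟨Y, ⟨hY, hYH, r, hr⟩, hmax⟩ :=
    (I.stableFiltration_stable (⊤ : Submodule R M)).exists_maximal_of_le (S := S)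
      ⟨_, le_rfl, shiftFiltration_le_h0Filtration, 0, isGenericMultiplicity_shiftFiltration⟩
      (fun Y hY => hY.2.1.trans h0Filtration_le)
  suffices H ≤ Y by
    rw [← le_antisymm hYH this]
    exact ⟨r, hr⟩
  intro n x hx
  by_contra hxY
  have hex : ∃ k, ∀ c ∈ 𝔪 ^ k, c • x ∈ Y.N n := by
    obtain ⟨-, k, hk⟩ := hx
    exact ⟨k, fun c hc => hY n (hk c hc)⟩
  classical
  obtain ⟨k, hk⟩ : ∃ k, Nat.find hex = k + 1 := by
    refine Nat.exists_eq_succ_of_ne_zero fun h0 => hxY ?_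
    have := Nat.find_spec hex
    rw [h0] at this
    simpa using this 1 (by simp)
  have h1 := Nat.find_spec hex
  have h2 := Nat.find_min hex (show k < Nat.find hex by omega)
  push Not at h2
  rw [hk] at h1
  obtain ⟨c, hc, hcx⟩ := h2
  have hcH : c • x ∈ H.N n := Submodule.smul_mem _ _ hx
  obtain ⟨r', hr'⟩ := hr.exists_sup hg hY (hYH.trans h0Filtration_le) hcH.1 (fun a ha => by
    rw [smul_smul]
    refine h1 _ ?_
    rw [pow_succ']
    exact Ideal.mul_mem_mul ha hc)
  refine hcx (hmax _ ⟨hY.trans le_sup_left, sup_le hYH (cyclicFiltration_le hcH), r', hr'⟩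
    le_sup_left n ?_)
  change c • x ∈ (Y ⊔ cyclicFiltration I (c • x) n).N n
  rw [Ideal.Filtration.sup_N]
  refine Submodule.mem_sup_right ?_
  simp [cyclicFiltration]

end Generic

/-- The graded evaluation `f ↦ ∑ₑ fₑ(g) Xᵉ`, where `fₑ` is the component of degree `e`. -/
def gradedEval {ι A : Type*} [CommRing A] (g : ι → A) :
    MvPolynomial ι A →ₐ[A] Polynomial A :=
  MvPolynomial.aeval fun i => Polynomial.C (g i) * Polynomial.X

lemma coeff_gradedEval {ι A : Type*} [CommRing A] (g : ι → A) (f : MvPolynomial ι A) (e : ℕ) :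
    (gradedEval g f).coeff e = (MvPolynomial.homogeneousComponent e f).eval g := by
  induction f using MvPolynomial.induction_on' with
  | add p q hp hq => simp [hp, hq]
  | monomial s a =>
    have h1 : gradedEval g (MvPolynomial.monomial s a) =
        Polynomial.monomial s.degree ((MvPolynomial.monomial s a).eval g) := by
      rw [gradedEval, MvPolynomial.aeval_monomial, MvPolynomial.eval_monomial,
        ← Polynomial.C_mul_X_pow_eq_monomial, Finsupp.prod, Finsupp.prod]
      simp only [mul_pow, Finset.prod_mul_distrib, Finset.prod_pow_eq_pow_sum,
        Polynomial.C_mul, map_prod, Polynomial.C_pow, Polynomial.algebraMap_eq, mul_assoc]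
      rfl
    rw [h1, Polynomial.coeff_monomial]
    have h2 : (MvPolynomial.monomial s a).IsHomogeneous s.degree :=
      MvPolynomial.isHomogeneous_monomial a rfl
    split_ifs with h
    · subst h
      rw [MvPolynomial.homogeneousComponent_of_mem h2, if_pos rfl]
    · rw [MvPolynomial.homogeneousComponent_of_mem h2, if_neg (Ne.symm h), map_zero]

lemma coeff_gradedEval_mem {ι A : Type*} [CommRing A] (g : ι → A) (f : MvPolynomial ι A) (e : ℕ) :
    (gradedEval g f).coeff e ∈ Ideal.span (Set.range g) ^ e := by
  have h : gradedEval g f ∈ reesAlgebra (Ideal.span (Set.range g)) := by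
    have h1 : (gradedEval g).range ≤ reesAlgebra (Ideal.span (Set.range g)) := by
      rw [gradedEval, ← Algebra.adjoin_range_eq_range_aeval, Algebra.adjoin_le_iff]
      rintro _ ⟨i, rfl⟩
      simp only [Polynomial.C_mul_X_eq_monomial]
      exact reesAlgebra.monomial_mem.2 (by
        rw [pow_one]; exact Ideal.subset_span ⟨i, rfl⟩)
    exact h1 ⟨f, rfl⟩
  exact (mem_reesAlgebra_iff _ _).1 h e

/-- The polynomials whose components of degree `e` take values in `(g)^(e+1)` at `g`: the kernel
of the presentation of the associated graded ring of the ideal `(g)`. -/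
def gradedKer {ι A : Type*} [CommRing A] (g : ι → A) : Ideal (MvPolynomial ι A) where
  carrier := {f | ∀ e, (gradedEval g f).coeff e ∈ Ideal.span (Set.range g) ^ (e + 1)}
  add_mem' := fun ha hb e => by
    rw [map_add, Polynomial.coeff_add]
    exact add_mem (ha e) (hb e)
  zero_mem' := fun e => by simp
  smul_mem' := fun c f hf e => by
    rw [smul_eq_mul, map_mul, Polynomial.coeff_mul]
    refine Ideal.sum_mem _ fun x hx => ?_
    have h := Ideal.mul_mem_mul (coeff_gradedEval_mem g c x.1) (hf x.2)
    rwa [← pow_add, ← add_assoc, Finset.HasAntidiagonal.mem_antidiagonal.1 hx] at h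

lemma C_mem_gradedKer {ι A : Type*} [CommRing A] {g : ι → A} {y : A}
    (hy : y ∈ Ideal.span (Set.range g)) : MvPolynomial.C y ∈ gradedKer g := by
  intro e
  rw [← MvPolynomial.algebraMap_eq, AlgHom.commutes, Polynomial.algebraMap_apply,
    Polynomial.coeff_C]
  split_ifs with h
  · simpa [h] using hy
  · exact zero_mem _

/-- If every prime between `gradedKer g` and the polynomials with coefficients in the maximal
ideal contains the maximal ideal, then some form with a unit coefficient multiplies a power of the
maximal ideal into `gradedKer g`. -/
lemma exists_mul_C_mem_gradedKer {ι A : Type*} [CommRing A] [IsLocalRing A]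
    [IsNoetherianRing A] (g : ι → A)
    (hQ : ∀ Q : Ideal (MvPolynomial ι A), Q.IsPrime → gradedKer g ≤ Q →
      Q ≤ residueKer (IsLocalRing.maximalIdeal A) ι →
      ∀ y ∈ IsLocalRing.maximalIdeal A, MvPolynomial.C y ∈ Q) :
    ∃ s ∉ residueKer (IsLocalRing.maximalIdeal A) ι, ∃ k,
      ∀ y ∈ IsLocalRing.maximalIdeal A ^ k, s * MvPolynomial.C y ∈ gradedKer g := by
  set 𝔪 := IsLocalRing.maximalIdeal A
  set P := residueKer 𝔪 ι
  let 𝔟 : Ideal A :=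
    { carrier := {y | ∃ s ∉ P, s * MvPolynomial.C y ∈ gradedKer g}
      add_mem' := by
        rintro x y ⟨s, hs, hsx⟩ ⟨t, ht, hty⟩
        refine ⟨s * t, fun h => ?_, ?_⟩
        · exact (Ideal.IsPrime.mem_or_mem inferInstance h).elim hs ht
        · rw [map_add, mul_add, mul_right_comm, mul_assoc s t]
          exact add_mem (Ideal.mul_mem_right _ _ hsx) (Ideal.mul_mem_left _ _ hty)
      zero_mem' := ⟨1, (Ideal.ne_top_iff_one P).1 Ideal.IsPrime.ne_top', by simp⟩
      smul_mem' := by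
        rintro c x ⟨s, hs, hsx⟩
        refine ⟨s, hs, ?_⟩
        rw [smul_eq_mul, map_mul, mul_left_comm]
        exact Ideal.mul_mem_left _ _ hsx }
  have hrad : 𝔪 ≤ 𝔟.radical := by
    intro y hy
    by_contra hcon
    have hdis : Disjoint (gradedKer g : Set (MvPolynomial ι A))
        (P.primeCompl ⊔ Submonoid.powers (MvPolynomial.C y) : Submonoid _) := by
      rw [Set.disjoint_left]
      intro f hf hf'
      obtain ⟨s, hs, _, ⟨n, rfl⟩, rfl⟩ := Submonoid.mem_sup.1 hf'
      refine hcon ⟨n, s, hs, ?_⟩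
      simpa using hf
    obtain ⟨Q, hQp, hQle, hQd⟩ := Ideal.exists_le_prime_disjoint _ _ hdis
    have hQP : Q ≤ P := by
      intro f hf
      by_contra hfP
      exact Set.disjoint_left.1 hQd hf ((le_sup_left : P.primeCompl ≤ _) hfP)
    exact Set.disjoint_left.1 hQd (hQ Q hQp hQle hQP y hy)
      ((le_sup_right : Submonoid.powers (MvPolynomial.C y) ≤ P.primeCompl ⊔ _)
        (Submonoid.mem_powers _))
  obtain ⟨k, hk⟩ := Ideal.exists_pow_le_of_le_radical_of_fg hrad (IsNoetherian.noetherian _)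
  have key : ∀ J : Ideal A, J.FG → J ≤ 𝔟 →
      ∃ s ∉ P, ∀ y ∈ J, s * MvPolynomial.C y ∈ gradedKer g := by
    intro J hJ
    induction J, hJ using Submodule.fg_induction with
    | singleton x =>
      intro hx
      obtain ⟨s, hs, hsx⟩ := hx (Submodule.mem_span_singleton_self x)
      refine ⟨s, hs, fun y hy => ?_⟩
      obtain ⟨c, rfl⟩ := Submodule.mem_span_singleton.1 hy
      rw [smul_eq_mul, map_mul, mul_left_comm]
      exact Ideal.mul_mem_left _ _ hsx
    | sup J K _ _ hJ hK =>
      intro hJK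
      obtain ⟨s, hs, hsJ⟩ := hJ (le_sup_left.trans hJK)
      obtain ⟨t, ht, htK⟩ := hK (le_sup_right.trans hJK)
      refine ⟨s * t, fun h => ?_, fun y hy => ?_⟩
      · exact (Ideal.IsPrime.mem_or_mem inferInstance h).elim hs ht
      · obtain ⟨x, hx, z, hz, rfl⟩ := Submodule.mem_sup.1 hy
        rw [map_add, mul_add, mul_right_comm, mul_assoc s t]
        exact add_mem (Ideal.mul_mem_right _ _ (hsJ x hx)) (Ideal.mul_mem_left _ _ (htK z hz))
  obtain ⟨s, hs, h⟩ := key (𝔪 ^ k) (IsNoetherian.noetherian _) hk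
  exact ⟨s, hs, k, h⟩

lemma exists_form_eval_mul_mem {ι A : Type*} [CommRing A] {𝔪 : Ideal A} {g : ι → A} {k : ℕ}
    {s : MvPolynomial ι A} (hs : s ∉ residueKer 𝔪 ι)
    (h : ∀ y ∈ 𝔪 ^ k, s * MvPolynomial.C y ∈ gradedKer g) :
    ∃ (t : MvPolynomial ι A) (e : ℕ), t.IsHomogeneous e ∧ t ∉ residueKer 𝔪 ι ∧
      ∀ y ∈ 𝔪 ^ k, t.eval g * y ∈ Ideal.span (Set.range g) ^ (e + 1) := by
  rw [mem_residueKer] at hs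
  push Not at hs
  obtain ⟨m, hm⟩ := hs
  refine ⟨MvPolynomial.homogeneousComponent m.degree s, m.degree,
    MvPolynomial.homogeneousComponent_isHomogeneous _ _, fun hcon => ?_, fun y hy => ?_⟩
  · have := mem_residueKer.1 hcon m
    rw [MvPolynomial.coeff_homogeneousComponent, if_pos rfl] at this
    exact hm this
  · have := h y hy m.degree
    rw [map_mul, ← MvPolynomial.algebraMap_eq, AlgHom.commutes, Polynomial.algebraMap_apply,
      Polynomial.coeff_mul_C, coeff_gradedEval] at this
    exact this

/-- The substitution `X i ↦ f (g i) X i₀` for `i ∈ U` and for `i = i₀`. -/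
def partialGradedEval {ι A B : Type*} [CommRing A] [CommRing B] (f : A →+* B) (g : ι → A)
    (i₀ : ι) (U : Finset ι) : MvPolynomial ι A →+* MvPolynomial ι B :=
  open Classical in
  MvPolynomial.eval₂Hom (MvPolynomial.C.comp f) fun i =>
    if i ∈ U ∨ i = i₀ then MvPolynomial.C (f (g i)) * MvPolynomial.X i₀ else MvPolynomial.X i

lemma ker_partialGradedEval_lt {ι A B : Type*} [CommRing A] [CommRing B] [DecidableEq ι]
    (f : A →+* B) (g : ι → A) {i₀ j : ι} {U : Finset ι} (hj : j ∉ U) (hj₀ : j ≠ i₀)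
    (hg : f (g i₀) ≠ 0) :
    RingHom.ker (partialGradedEval f g i₀ U) <
      RingHom.ker (partialGradedEval f g i₀ (insert j U)) := by
  classical
  refine lt_of_le_of_ne ?_ ?_
  · let σ : MvPolynomial ι B →+* MvPolynomial ι B := MvPolynomial.eval₂Hom MvPolynomial.C
      fun i => if i = j then MvPolynomial.C (f (g i)) * MvPolynomial.X i₀ else MvPolynomial.X i
    have hσ : partialGradedEval f g i₀ (insert j U) =
        σ.comp (partialGradedEval f g i₀ U) := by
      refine MvPolynomial.ringHom_ext (fun r => ?_) (fun i => ?_)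
      · simp [partialGradedEval, σ]
      · by_cases h1 : i = j
        · subst h1
          simp [partialGradedEval, σ, hj, hj₀]
        · by_cases h2 : i ∈ U ∨ i = i₀
          · simp [partialGradedEval, σ, h1, h2, Ne.symm hj₀]
          · simp [partialGradedEval, σ, h1, h2]
    rw [hσ]
    intro p hp
    rw [RingHom.mem_ker] at hp ⊢
    rw [RingHom.comp_apply, hp, map_zero]
  · intro heq
    have h1 : MvPolynomial.C (g i₀) * MvPolynomial.X j - MvPolynomial.C (g j) * MvPolynomial.X i₀ ∈
        RingHom.ker (partialGradedEval f g i₀ (insert j U)) := by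
      rw [RingHom.mem_ker]
      simp [partialGradedEval]
      ring
    rw [← heq, RingHom.mem_ker] at h1
    have h2 := congrArg (MvPolynomial.coeff (Finsupp.single j 1)) h1
    simp [partialGradedEval, hj, hj₀, MvPolynomial.coeff_C_mul, MvPolynomial.coeff_X,
      Finsupp.single_left_inj, Ne.symm hj₀] at h2
    exact hg h2

lemma card_le_height_ker_partialGradedEval {ι A B : Type*} [CommRing A] [CommRing B] [IsDomain B]
    (f : A →+* B) (g : ι → A) {i₀ : ι} (hg : f (g i₀) ≠ 0) (U : Finset ι) (hU : i₀ ∉ U) :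
    (U.card : ℕ∞) ≤ (RingHom.ker (partialGradedEval f g i₀ U)).height := by
  classical
  induction U using Finset.induction_on with
  | empty => simp
  | insert j U hj ih =>
    rw [Finset.card_insert_of_notMem hj, Nat.cast_add, Nat.cast_one]
    have hj₀ : j ≠ i₀ := fun h => hU (h ▸ Finset.mem_insert_self _ _)
    refine (add_le_add_left (ih fun h => hU (Finset.mem_insert_of_mem h)) 1).trans ?_
    have h1 := RingHom.ker_isPrime (partialGradedEval f g i₀ U)
    have h2 := RingHom.ker_isPrime (partialGradedEval f g i₀ (insert j U))
    exact Ideal.height_add_one_le_of_lt_of_isPrime (ker_partialGradedEval_lt f g hj hj₀ hg)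

lemma card_le_height_of_gradedKer_le {ι A : Type*} [Fintype ι] [Nonempty ι] [CommRing A]
    [IsLocalRing A]
    [IsNoetherianRing A] (g : ι → A) (Q : Ideal (MvPolynomial ι A)) [Q.IsPrime]
    (hQ : gradedKer g ≤ Q) (hQP : Q ≤ residueKer (IsLocalRing.maximalIdeal A) ι) :
    (Fintype.card ι : ℕ∞) ≤ Q.height := by
  classical
  let ψ : Ideal A → Ideal (MvPolynomial ι A) := fun 𝔭 =>
    RingHom.ker ((Polynomial.mapRingHom (Ideal.Quotient.mk 𝔭)).comp
      (gradedEval g : MvPolynomial ι A →+* Polynomial A))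
  have hfin := minimalPrimes.finite_of_isNoetherianRing A
  have hinf : hfin.toFinset.inf ψ ≤ Q := by
    intro f hf
    have h1 : IsNilpotent (gradedEval g f) := by
      rw [Polynomial.isNilpotent_iff]
      intro i
      rw [← mem_nilradical, nilradical, ← Ideal.sInf_minimalPrimes, Ideal.mem_sInf]
      intro 𝔭 h𝔭
      have h2 : f ∈ ψ 𝔭 := (Finset.inf_le (f := ψ) (hfin.mem_toFinset.2 h𝔭)) hf
      have h3 := congrArg (fun p => Polynomial.coeff p i) (RingHom.mem_ker.1 h2)
      simpa [Ideal.Quotient.eq_zero_iff_mem] using h3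
    obtain ⟨n, hn⟩ := h1
    refine Ideal.IsPrime.mem_of_pow_mem inferInstance n (hQ fun e => ?_)
    rw [map_pow, hn]
    simp
  obtain ⟨𝔭, h𝔭, hle⟩ := (Ideal.IsPrime.inf_le' inferInstance).1 hinf
  have hp : 𝔭.IsPrime := (hfin.mem_toFinset.1 h𝔭).1.1
  obtain ⟨i₀, hi₀⟩ : ∃ i, g i ∉ 𝔭 := by
    by_contra hcon
    push Not at hcon
    obtain ⟨i⟩ := ‹Nonempty ι›
    have h1 : MvPolynomial.X i ∈ ψ 𝔭 := by
      rw [RingHom.mem_ker]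
      simp [gradedEval, Ideal.Quotient.eq_zero_iff_mem.2 (hcon i)]
    have h2 := mem_residueKer.1 (hQP (hle h1)) (Finsupp.single i 1)
    rw [MvPolynomial.coeff_X, if_pos rfl] at h2
    exact (Ideal.ne_top_iff_one _).1 (IsLocalRing.maximalIdeal.isMaximal A).ne_top h2
  have hg : Ideal.Quotient.mk 𝔭 (g i₀) ≠ 0 := fun h => hi₀ (Ideal.Quotient.eq_zero_iff_mem.1 h)
  have h1 := card_le_height_ker_partialGradedEval (Ideal.Quotient.mk 𝔭) g hg
    (Finset.univ.erase i₀) (Finset.notMem_erase _ _)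
  have h2 : RingHom.ker (partialGradedEval (Ideal.Quotient.mk 𝔭) g i₀ (Finset.univ.erase i₀)) ≤
      ψ 𝔭 := by
    let τ : MvPolynomial ι (A ⧸ 𝔭) →+* Polynomial (A ⧸ 𝔭) :=
      MvPolynomial.eval₂Hom Polynomial.C fun _ => Polynomial.X
    have hτ : (Polynomial.mapRingHom (Ideal.Quotient.mk 𝔭)).comp
        (gradedEval g : MvPolynomial ι A →+* Polynomial A) =
        τ.comp (partialGradedEval (Ideal.Quotient.mk 𝔭) g i₀ (Finset.univ.erase i₀)) := by
      refine MvPolynomial.ringHom_ext (fun r => ?_) (fun i => ?_)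
      · simp [partialGradedEval, τ, gradedEval]
      · by_cases h : i = i₀ <;> simp [partialGradedEval, τ, gradedEval, h]
    intro p hp
    rw [RingHom.mem_ker] at hp ⊢
    rw [hτ, RingHom.comp_apply, hp, map_zero]
  have h3 : ψ 𝔭 < Q := by
    refine lt_of_le_of_ne hle fun heq => ?_
    have h4 : MvPolynomial.C (g i₀) ∈ ψ 𝔭 :=
      heq ▸ hQ (C_mem_gradedKer (Ideal.subset_span ⟨i₀, rfl⟩))
    rw [RingHom.mem_ker] at h4
    simp [gradedEval] at h4
    exact hg h4
  have h5 : (ψ 𝔭).IsPrime := RingHom.ker_isPrime _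
  have h6 := Ideal.height_add_one_le_of_lt_of_isPrime h3
  refine le_trans ?_ ((add_le_add_left (h1.trans (Ideal.height_mono h2)) 1).trans h6)
  rw [Finset.card_erase_of_mem (Finset.mem_univ _), Finset.card_univ]
  have : 0 < Fintype.card ι := Fintype.card_pos
  norm_cast
  omega

lemma height_residueKer_le {ι A : Type*} [Fintype ι] [CommRing A] [IsLocalRing A]
    [IsNoetherianRing A] :
    (residueKer (IsLocalRing.maximalIdeal A) ι).height ≤ (IsLocalRing.maximalIdeal A).height := by
  classical
  set 𝔪 := IsLocalRing.maximalIdeal A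
  set P := residueKer 𝔪 ι
  have hC : P = 𝔪.map (algebraMap A (MvPolynomial ι A)) := by
    rw [MvPolynomial.algebraMap_eq]
    ext f
    rw [MvPolynomial.mem_map_C_iff, mem_residueKer]
  have : P.LiesOver 𝔪 := by
    refine ⟨?_⟩
    ext y
    rw [Ideal.under, Ideal.mem_comap, MvPolynomial.algebraMap_eq, mem_residueKer]
    constructor
    · intro hy m
      rw [MvPolynomial.coeff_C]
      split_ifs
      · exact hy
      · exact zero_mem _
    · intro h
      simpa using h 0
  have h := Ideal.height_le_height_add_of_liesOver 𝔪 P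
  have h2 : P.map (Ideal.Quotient.mk (𝔪.map (algebraMap A (MvPolynomial ι A)))) = ⊥ := by
    rw [← hC, Ideal.map_quotient_self]
  have h3 : (𝔪.map (algebraMap A (MvPolynomial ι A))).IsPrime := by
    rw [← hC]; infer_instance
  rw [h2, Ideal.height_bot, add_zero] at h
  exact h

/-- If `g` consists of at least `dim A` elements, a power of the maximal ideal is multiplied into
`(g)^(e+1)` by some form of degree `e` in `g` with a unit coefficient. -/
lemma exists_form_eval_mul_mem_of_ringKrullDim_le {ι A : Type*} [Fintype ι] [Nonempty ι]
    [CommRing A] [IsLocalRing A] [IsNoetherianRing A] (g : ι → A)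
    (hdim : ringKrullDim A ≤ (Fintype.card ι : ℕ)) :
    ∃ k, ∃ (t : MvPolynomial ι A) (e : ℕ), t.IsHomogeneous e ∧
      t ∉ residueKer (IsLocalRing.maximalIdeal A) ι ∧
      ∀ y ∈ IsLocalRing.maximalIdeal A ^ k, t.eval g * y ∈ Ideal.span (Set.range g) ^ (e + 1) := by
  classical
  obtain ⟨s, hs, k, h⟩ := exists_mul_C_mem_gradedKer g fun Q hQp hQ hQP => by
    have hle := card_le_height_of_gradedKer_le g Q hQ hQP
    have hPQ : Q = residueKer (IsLocalRing.maximalIdeal A) ι := by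
      by_contra hne
      have h1 := Ideal.height_add_one_le_of_lt_of_isPrime (lt_of_le_of_ne hQP hne)
      have h2 := h1.trans height_residueKer_le
      have h3 : ((IsLocalRing.maximalIdeal A).height : WithBot ℕ∞) ≤ (Fintype.card ι : ℕ) :=
        Ideal.height_le_ringKrullDim_of_isPrime.trans hdim
      have h4 : (IsLocalRing.maximalIdeal A).height ≤ (Fintype.card ι : ℕ) := by
        exact_mod_cast h3
      have h5 := ((add_le_add_left hle 1).trans h2).trans h4
      norm_cast at h5
      omega
    intro y hy
    rw [hPQ, mem_residueKer]
    intro m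
    rw [MvPolynomial.coeff_C]
    split_ifs
    · exact hy
    · exact zero_mem _
  exact ⟨k, exists_form_eval_mul_mem hs h⟩

lemma exists_form_smul_mem_h0Filtration {ι R M : Type*} [Fintype ι] [Nonempty ι] [CommRing R]
    [IsNoetherianRing R] [IsLocalRing R] [AddCommGroup M] [Module R M]
    (hdim : mDim R M ≤ ((Fintype.card ι : ℕ) : WithBot ℕ∞)) (g : ι → R) :
    ∃ (t : MvPolynomial ι R) (e : ℕ), t.IsHomogeneous e ∧
      t ∉ residueKer (IsLocalRing.maximalIdeal R) ι ∧
      ∀ n, ∀ x ∈ (Ideal.span (Set.range g) ^ n • ⊤ : Submodule R M), t.eval g • x ∈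
        (h0Filtration (IsLocalRing.maximalIdeal R) (Ideal.span (Set.range g)) M).N (n + e) := by
  set 𝔪 := IsLocalRing.maximalIdeal R with h𝔪
  set I := Ideal.span (Set.range g) with hI
  cases subsingleton_or_nontrivial M with
  | inl hM =>
    refine ⟨1, 0, MvPolynomial.isHomogeneous_one _ _,
      (Ideal.ne_top_iff_one _).1 Ideal.IsPrime.ne_top', fun n x hx => ?_⟩
    rw [Subsingleton.elim (MvPolynomial.eval g 1 • x) 0]
    exact zero_mem _
  | inr hM =>
    set J := Module.annihilator R M with hJ
    have hJt : J ≠ ⊤ := by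
      intro h
      rw [hJ, Module.annihilator_eq_top_iff] at h
      exact not_subsingleton M h
    have : Nontrivial (R ⧸ J) := Ideal.Quotient.nontrivial_iff.2 hJt
    have hloc : IsLocalRing (R ⧸ J) :=
      IsLocalRing.of_surjective' (Ideal.Quotient.mk J) Ideal.Quotient.mk_surjective
    have hlh : IsLocalHom (Ideal.Quotient.mk J) :=
      IsLocalHom.of_surjective _ Ideal.Quotient.mk_surjective
    have hmk : ∀ y ∈ 𝔪, Ideal.Quotient.mk J y ∈ IsLocalRing.maximalIdeal (R ⧸ J) := by
      intro y hy
      rw [IsLocalRing.mem_maximalIdeal, mem_nonunits_iff] at hy ⊢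
      exact fun h => hy (isUnit_of_map_unit _ _ h)
    have hmk' : 𝔪.map (Ideal.Quotient.mk J) ≤ IsLocalRing.maximalIdeal (R ⧸ J) :=
      Ideal.map_le_iff_le_comap.2 hmk
    obtain ⟨k, s, e, hse, hs, hsk⟩ := exists_form_eval_mul_mem_of_ringKrullDim_le
      (fun i => Ideal.Quotient.mk J (g i)) hdim
    obtain ⟨t, rfl⟩ := MvPolynomial.map_surjective (Ideal.Quotient.mk J)
      Ideal.Quotient.mk_surjective s
    have hmap : MvPolynomial.map (Ideal.Quotient.mk J) (MvPolynomial.homogeneousComponent e t) =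
        MvPolynomial.map (Ideal.Quotient.mk J) t := by
      ext m
      rw [MvPolynomial.coeff_map, MvPolynomial.coeff_map, MvPolynomial.coeff_homogeneousComponent]
      split_ifs with h
      · rfl
      · rw [map_zero, ← MvPolynomial.coeff_map, hse.coeff_eq_zero h]
    refine ⟨MvPolynomial.homogeneousComponent e t, e,
      MvPolynomial.homogeneousComponent_isHomogeneous _ _, fun hcon => hs ?_, fun n x hx => ?_⟩
    · rw [← hmap, mem_residueKer]
      intro m
      rw [MvPolynomial.coeff_map]
      exact hmk _ (mem_residueKer.1 hcon m)
    · have hev : Ideal.Quotient.mk J ((MvPolynomial.homogeneousComponent e t).eval g) =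
          (MvPolynomial.map (Ideal.Quotient.mk J) t).eval fun i => Ideal.Quotient.mk J (g i) := by
        rw [← hmap, MvPolynomial.eval_map]
        exact MvPolynomial.eval₂_comp _ g _
      have hte : (MvPolynomial.homogeneousComponent e t).eval g ∈ I ^ e :=
        (Ideal.mem_span_pow_iff_exists_isHomogeneous g _).2
          ⟨_, MvPolynomial.homogeneousComponent_isHomogeneous _ _, rfl⟩
      rw [mem_h0Filtration]
      refine ⟨?_, k, fun c hc => ?_⟩
      · rw [add_comm, pow_add, mul_smul]
        exact Submodule.smul_mem_smul hte hx
      · have h1 := hsk (Ideal.Quotient.mk J c) (Ideal.pow_right_mono hmk' k (by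
          rw [← Ideal.map_pow]; exact Ideal.mem_map_of_mem _ hc))
        have h2 : Ideal.span (Set.range fun i => Ideal.Quotient.mk J (g i)) =
            I.map (Ideal.Quotient.mk J) := by
          rw [hI, Ideal.map_span, ← Set.range_comp]; rfl
        rw [← hev, ← map_mul, h2, ← Ideal.map_pow,
          Ideal.mem_map_iff_of_surjective _ Ideal.Quotient.mk_surjective] at h1
        obtain ⟨z, hz, hzt⟩ := h1
        have h3 := Ideal.Quotient.eq.1 hzt
        have h4 := Module.mem_annihilator.1 h3 x
        rw [sub_smul, sub_eq_zero] at h4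
        rw [smul_smul, mul_comm, ← h4, add_assoc, add_comm n, pow_add, mul_smul]
        exact Submodule.smul_mem_smul hz hx

section LocalCohomology

variable {R M : Type*} [CommRing R] [AddCommGroup M] [Module R M]

lemma mem_H0 {I : Ideal R} {x : M} : x ∈ H0 I M ↔ ∃ k, ∀ c ∈ I ^ k, c • x = 0 := by
  have hdir : Directed (· ≤ ·) fun n : ℕ =>
      Submodule.torsionBySet R M ((I ^ n : Ideal R) : Set R) := by
    refine Monotone.directed_le fun m n hmn => ?_
    exact Submodule.torsionBySet_le_torsionBySet_of_subset (Ideal.pow_le_pow_right hmn)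
  rw [H0, Submodule.mem_iSup_of_directed _ hdir]
  simp [Submodule.mem_torsionBySet_iff]

lemma mem_satur {I : Ideal R} {K : Submodule R M} {x : M} :
    x ∈ satur I K ↔ ∃ k, ∀ c ∈ I ^ k, c • x ∈ K := by
  rw [satur, Submodule.mem_comap, mem_H0]
  simp [Submodule.Quotient.mk_eq_zero, ← Submodule.Quotient.mk_smul]

lemma mLength_H0_gradedPiece (𝔪 I : Ideal R) (n : ℕ) :
    mLength R (H0 𝔪 (gradedPiece I (M := M) n)) =
      relLength ((h0Filtration 𝔪 I M).N n) ((I ^ (n + 1) • ⊤ : Submodule R M)) := by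
  rw [mLength_eq_length, ← relLength_map_mkQ]
  have h : (H0 𝔪 (gradedPiece I (M := M) n)).map (gradedPiece I (M := M) n).subtype =
      ((h0Filtration 𝔪 I M).N n).map (I ^ (n + 1) • ⊤ : Submodule R M).mkQ := by
    ext z
    constructor
    · rintro ⟨⟨_, x, hx, rfl⟩, hy, rfl⟩
      obtain ⟨k, hk⟩ := mem_H0.1 hy
      refine ⟨x, ⟨hx, k, fun c hc => ?_⟩, rfl⟩
      have := congrArg Subtype.val (hk c hc)
      simpa [← Submodule.Quotient.mk_smul, Submodule.Quotient.mk_eq_zero] using this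
    · rintro ⟨x, ⟨hx, k, hk⟩, rfl⟩
      refine ⟨⟨_, x, hx, rfl⟩, mem_H0.2 ⟨k, fun c hc => ?_⟩, rfl⟩
      ext
      simpa [← Submodule.Quotient.mk_smul, Submodule.Quotient.mk_eq_zero] using hk c hc
  rw [← h]
  exact (Submodule.equivMapOfInjective _ (Submodule.subtype_injective _) _).length_eq

end LocalCohomology

section Fiber

variable {R M ι : Type*} [CommRing R] [AddCommGroup M] [Module R M] {I : Ideal R}
  {g : ι → R} {𝔄 : Ideal R} {b : R} {p : ι → R}

lemma IsTorFree.exists_pow_smul_mem (hb : b ∈ I)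
    (ht : IsTorFree 𝔄 b (I.stableFiltration (⊤ : Submodule R M)))
    (δ : ℕ) : ∀ (j : ℕ) (x : M), b ^ (j + 1 + δ) • x ∈ 𝔄 • (I ^ j • ⊤ : Submodule R M) →
      ∃ N ≥ j, b ^ (N + 1) • x ∈ 𝔄 • (I ^ N • ⊤ : Submodule R M) := by
  obtain ⟨E, hE⟩ := ht
  induction δ with
  | zero => exact fun j x hx => ⟨j, le_rfl, hx⟩
  | succ δ ih =>
    intro j x hx
    have h1 : b ^ (j + 1 + (δ + 1)) • x ∈ (shiftFiltration I M).N (j + 1) :=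
      Submodule.smul_mem_smul (Ideal.pow_le_pow_right (by omega) (Ideal.pow_mem_pow hb _))
        Submodule.mem_top
    have h2 := hE j _ hx h1
    rw [smul_smul, ← pow_add, show E + (j + 1 + (δ + 1)) = j + E + 1 + 1 + δ by omega] at h2
    obtain ⟨N, hN, h⟩ := ih (j + E + 1) x h2
    exact ⟨N, by omega, h⟩

/-- The fiber length of the Rees module of `M` at a point where it is torsion free. -/
lemma HasFiberLength.length_quotient_eq (h : IsCoord g 𝔄 b p) (hg : Ideal.span (Set.range g) = I)
    [IsNoetherianRing R] [Module.Finite R M] {r : ℕ}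
    (hr : HasFiberLength 𝔄 (I.stableFiltration (⊤ : Submodule R M)) r)
    (ht : IsTorFree 𝔄 b (I.stableFiltration (⊤ : Submodule R M))) :
    Module.length R (M ⧸ (satur I (𝔄 • ⊤ : Submodule R M) ⊔ Ideal.span {b} • ⊤)) = r := by
  have hIb : ∀ j, I ^ (j + 1) ≤ Ideal.span {b ^ (j + 1)} ⊔ 𝔄 * I ^ j := hg ▸ h.span_pow_succ_le
  have hIM : ∀ j, (I ^ (j + 1) • ⊤ : Submodule R M) ≤
      (⊤ : Submodule R M).map (LinearMap.lsmul R M (b ^ (j + 1))) ⊔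
        𝔄 • (I ^ j • ⊤ : Submodule R M) := by
    intro j
    rw [← mul_smul, ← span_singleton_smul_eq_map, ← Submodule.sup_smul]
    exact Submodule.smul_mono_left (hIb j)
  have hmap : ∀ j, (⊤ : Submodule R M).map (LinearMap.lsmul R M (b ^ j)) ≤ I ^ j • ⊤ := by
    intro j
    rw [← span_singleton_smul_eq_map]
    exact Submodule.smul_mono_left
      ((Ideal.span_singleton_le_iff_mem _).2 (Ideal.pow_mem_pow (hg ▸ h.mem_span) j))
  have hb : b ∈ I := hg ▸ h.mem_span
  have hA : 𝔄 ≤ I := hg ▸ h.le_span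
  obtain ⟨n₁, h₁⟩ := hr.injective h hg (fun n => Submodule.smul_mono_left
    (Ideal.pow_le_pow_right (by omega))) (I.stableFiltration_stable _)
  obtain ⟨n₂, h₂⟩ := hr
  set n := max n₁ n₂
  set D : Submodule R M := 𝔄 • (I ^ n • ⊤ : Submodule R M) ⊔ I ^ (n + 2) • ⊤ with hD
  have key : D.comap (LinearMap.lsmul R M (b ^ (n + 1))) =
      satur I (𝔄 • ⊤ : Submodule R M) ⊔ Ideal.span {b} • ⊤ := by
    apply le_antisymm
    · intro x hx
      obtain ⟨u, hu, v, hv, huv⟩ := Submodule.mem_sup.1 (Submodule.mem_comap.1 hx)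
      obtain ⟨_, ⟨y, -, rfl⟩, w, hw, hyw⟩ := Submodule.mem_sup.1 (hIM (n + 1) hv)
      rw [← sub_add_cancel x (b • y)]
      refine Submodule.add_mem_sup (mem_satur.2 ⟨n + 1, fun c hc => ?_⟩)
        (Submodule.smul_mem_smul (Ideal.mem_span_singleton_self b) Submodule.mem_top)
      have h4 : b ^ (n + 1) • (x - b • y) = u + w := by
        simp only [LinearMap.lsmul_apply] at huv hyw
        rw [smul_sub, ← huv, ← hyw, smul_smul, ← pow_succ]
        abel
      obtain ⟨_, hs, a, ha, rfl⟩ := Submodule.mem_sup.1 (hIb n hc)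
      obtain ⟨s, rfl⟩ := Ideal.mem_span_singleton'.1 hs
      rw [add_smul, mul_smul, h4]
      have h5 : ∀ j, 𝔄 • (I ^ j • ⊤ : Submodule R M) ≤ 𝔄 • ⊤ :=
        fun j => smul_mono_right 𝔄 le_top
      have h6 : a ∈ 𝔄 := (Ideal.mul_le_left : 𝔄 * I ^ n ≤ 𝔄) ha
      exact add_mem (Submodule.smul_mem _ _ (add_mem (h5 n hu) (h5 (n + 1) hw)))
        (Submodule.smul_mem_smul h6 Submodule.mem_top)
    · refine sup_le (fun x hx => ?_) ?_
      · obtain ⟨k, hk⟩ := mem_satur.1 hx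
        obtain ⟨N, -, hN⟩ := ht.exists_pow_smul_mem hb k 0 x (by
          rw [pow_zero, Ideal.one_eq_top, Submodule.top_smul, zero_add, pow_add, mul_smul]
          exact Submodule.smul_mem _ _ (hk _ (Ideal.pow_mem_pow hb k)))
        refine h₁ n (le_max_left _ _) N _
          (Submodule.smul_mem_smul (Ideal.pow_mem_pow hb _) Submodule.mem_top)
          (Submodule.mem_sup_left ?_)
        change b ^ N • b ^ (n + 1) • x ∈ 𝔄 • (I ^ (n + N) • ⊤ : Submodule R M)
        have h4 : b ^ N • b ^ (n + 1) • x = b ^ n • b ^ (N + 1) • x := by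
          rw [smul_smul, smul_smul, ← pow_add, ← pow_add]
          congr 2
          omega
        have h5 := Submodule.smul_mem_smul (Ideal.pow_mem_pow hb n) hN
        rw [← mul_smul, ← mul_smul, mul_right_comm, ← pow_add, mul_comm, mul_smul] at h5
        rwa [h4]
      · rw [span_singleton_smul_eq_map]
        rintro _ ⟨y, -, rfl⟩
        refine Submodule.mem_sup_right ?_
        rw [LinearMap.lsmul_apply, LinearMap.lsmul_apply, smul_smul, ← pow_succ]
        exact Submodule.smul_mem_smul (Ideal.pow_mem_pow hb _) Submodule.mem_top
  have h3 : relLength (I ^ (n + 1) • ⊤ : Submodule R M) D = r := h₂ n (le_max_right _ _)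
  rw [← relLength_top, ← key, relLength_comap, ← h3, ← relLength_sup,
    ← relLength_sup (I ^ (n + 1) • ⊤)]
  congr 1
  refine le_antisymm (sup_le_sup_right (hmap _) _) (sup_le ((hIM n).trans ?_) le_sup_right)
  exact sup_le_sup_left le_sup_left _

end Fiber

/-- The sequence in the definition of `jMult`, in terms of `h0Filtration`. -/
lemma jMult_eq_limUnder {R M : Type*} [CommRing R] [AddCommGroup M] [Module R M]
    (𝔪 I : Ideal R) (d : ℕ) :
    jMult 𝔪 I M d = limUnder atTop fun n : ℕ => ((d - 1).factorial : ℝ) / (n : ℝ) ^ (d - 1) *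
      ((relLength ((h0Filtration 𝔪 I M).N n) ((shiftFiltration I M).N n)).toNat : ℝ) := by
  unfold jMult
  simp only [mLength_H0_gradedPiece]
  rfl

section JMult

variable {R M : Type*} [CommRing R] [IsNoetherianRing R] [IsLocalRing R] [AddCommGroup M]
  [Module R M] [Module.Finite R M] {I : Ideal R}

lemma exists_form_jMult_eq {q : ℕ} (hdim : mDim R M ≤ ((q + 1 : ℕ) : WithBot ℕ∞))
    {g : Fin (q + 1) → R} (hg : Ideal.span (Set.range g) = I) :
    ∃ (t : MvPolynomial (Fin (q + 1)) R) (e : ℕ), t.IsHomogeneous e ∧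
      t ∉ residueKer (IsLocalRing.maximalIdeal R) (Fin (q + 1)) ∧
      ∀ 𝔄 b p, IsCoord g 𝔄 b p → IsUnit (t.eval p) →
        jMult (IsLocalRing.maximalIdeal R) I M (q + 1) =
          ((mLength R (M ⧸ (satur I (𝔄 • ⊤ : Submodule R M) ⊔ Ideal.span {b} • ⊤))).toNat : ℝ) := by
  obtain ⟨r, ⟨-, hlim⟩, t₁, e₁, h₁, h₁', hr⟩ :=
    exists_isGenericMultiplicity_h0Filtration (M := M) hg
  obtain ⟨t₂, e₂, h₂, h₂', ht₂⟩ := exists_form_smul_mem_h0Filtration (M := M)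
    (by simpa using hdim) g
  rw [hg] at ht₂
  refine ⟨t₁ * t₂, e₁ + e₂, h₁.mul h₂, fun h =>
    (Ideal.IsPrime.mem_or_mem inferInstance h).elim h₁' h₂', fun 𝔄 b p hc hu => ?_⟩
  rw [map_mul, IsUnit.mul_iff] at hu
  obtain ⟨h3, h4⟩ := hr 𝔄 b p hc hu.1
  have hG : (I.stableFiltration (⊤ : Submodule R M)).Stable := I.stableFiltration_stable _
  have h5 := h3.of_form_smul_le hc hg shiftFiltration_le_h0Filtration h0Filtration_le
    (hG.of_le h0Filtration_le) hG h₂ hu.2 ht₂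
  have h6 := h4.of_form_smul_le (Y' := I.stableFiltration ⊤) hc hg h₂ hu.2 ht₂
  rw [mLength_eq_length, h5.length_quotient_eq hc hg h6, jMult_eq_limUnder]
  exact hlim.limUnder_eq

lemma jMult_eq_zero {q d : ℕ} {g : Fin (q + 1) → R} (hg : Ideal.span (Set.range g) = I)
    (hd : q + 1 < d) : jMult (IsLocalRing.maximalIdeal R) I M d = 0 := by
  obtain ⟨r, ⟨-, hlim⟩, -⟩ := exists_isGenericMultiplicity_h0Filtration (M := M) hg
  obtain ⟨k, rfl⟩ := Nat.exists_eq_add_of_lt hd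
  rw [jMult_eq_limUnder]
  refine Tendsto.limUnder_eq ?_
  have h1 : Tendsto (fun n : ℕ => ((q + 1 + k).factorial : ℝ) / q.factorial / (n : ℝ) ^ (k + 1))
      atTop (nhds 0) :=
    (tendsto_const_nhds.div_atTop ((tendsto_pow_atTop (by omega)).comp tendsto_natCast_atTop_atTop))
  have h2 := h1.mul hlim
  rw [zero_mul] at h2
  refine h2.congr' ?_
  filter_upwards [eventually_gt_atTop 0] with n hn
  have hn' : (n : ℝ) ≠ 0 := by positivity
  have hq : (q.factorial : ℝ) ≠ 0 := by positivity
  rw [show q + 1 + k + 1 - 1 = q + 1 + k by omega, ← mul_assoc]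
  congr 1
  field_simp
  ring

end JMult

lemma MvPolynomial.IsHomogeneous.eval_mul_left {ι R : Type*} [CommRing R] {t : MvPolynomial ι R}
    {e : ℕ} (ht : t.IsHomogeneous e) (u : R) (p : ι → R) :
    t.eval (fun i => u * p i) = u ^ e * t.eval p := by
  rw [MvPolynomial.eval_eq, MvPolynomial.eval_eq, Finset.mul_sum]
  refine Finset.sum_congr rfl fun m hm => ?_
  have h : m.degree = e := by
    by_contra h
    exact MvPolynomial.mem_support_iff.1 hm (ht.coeff_eq_zero h)
  rw [← h, Finsupp.degree_apply, ← Finset.prod_pow_eq_pow_sum, mul_left_comm,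
    ← Finset.prod_mul_distrib]
  simp only [mul_pow]

lemma isCoord_of_matrix {R : Type*} [CommRing R] {q : ℕ}
    {W V : Matrix (Fin (q + 1)) (Fin (q + 1)) R} (h : W * V = 1) (g : Fin (q + 1) → R) :
    IsCoord g (Ideal.span (Set.range fun j : Fin q => W.mulVec g j.succ)) (W.mulVec g 0)
      (fun i => V i 0) := by
  have hWV : ∀ i, ∑ k, W i k * V k 0 = if i = 0 then 1 else 0 := by
    intro i
    rw [← Matrix.mul_apply, h, Matrix.one_apply]
  have hVW : V * W = 1 := mul_eq_one_comm.1 h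
  refine ⟨fun c hc => ?_, ⟨∑ k, MvPolynomial.C (W 0 k) * MvPolynomial.X k, ?_, ?_, ?_⟩, fun i => ?_⟩
  · obtain ⟨r, rfl⟩ := Ideal.mem_span_range_iff_exists_fun.1 hc
    refine ⟨∑ j, MvPolynomial.C (r j) * ∑ k, MvPolynomial.C (W j.succ k) * MvPolynomial.X k,
      ?_, ?_, ?_⟩
    · refine MvPolynomial.IsHomogeneous.sum _ _ _ fun j _ => MvPolynomial.IsHomogeneous.C_mul
        (MvPolynomial.IsHomogeneous.sum _ _ _ fun k _ => MvPolynomial.isHomogeneous_C_mul_X _ _) _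
    · simp [Matrix.mulVec, dotProduct]
    · simp [hWV]
  · exact MvPolynomial.IsHomogeneous.sum _ _ _ fun k _ => MvPolynomial.isHomogeneous_C_mul_X _ _
  · simp [Matrix.mulVec, dotProduct]
  · simp [hWV]
  · have h1 : g i = ∑ j, V i j * W.mulVec g j := by
      change g i = V.mulVec (W.mulVec g) i
      rw [Matrix.mulVec_mulVec, hVW, Matrix.one_mulVec]
    rw [h1, Fin.sum_univ_succ, add_sub_cancel_left]
    exact Ideal.sum_mem _ fun j _ => Ideal.mul_mem_left _ _ (Ideal.subset_span ⟨j, rfl⟩)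

lemma exists_matrix_mul_eq_one {R : Type*} [CommRing R] {q : ℕ} {β p : Fin (q + 1) → R}
    {i₀ : Fin (q + 1)} (hu : IsUnit (∑ i, β i * p i)) (hp : IsUnit (p i₀)) :
    ∃ (D : Matrix (Fin q) (Fin (q + 1)) R) (V : Matrix (Fin (q + 1)) (Fin (q + 1)) R) (u : R),
      IsUnit u ∧ (Matrix.of (Fin.cons β D : Fin (q + 1) → Fin (q + 1) → R)) * V = 1 ∧
      ∀ i, V i 0 = u * p i := by
  obtain ⟨u, hu⟩ := hu
  obtain ⟨v, hv⟩ := hp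
  let D : Matrix (Fin q) (Fin (q + 1)) R := fun j i =>
    (if i = i₀.succAbove j then p i₀ else 0) - if i = i₀ then p (i₀.succAbove j) else 0
  let V' : Fin q → Fin (q + 1) → R := fun j i =>
    ↑v⁻¹ * ((if i = i₀.succAbove j then 1 else 0) - ↑u⁻¹ * β (i₀.succAbove j) * p i)
  refine ⟨D, Matrix.of fun i => Fin.cons (↑u⁻¹ * p i) fun j => V' j i, ↑u⁻¹, Units.isUnit _, ?_,
    fun i => rfl⟩
  have hD : ∀ (j : Fin q) (z : Fin (q + 1) → R), ∑ i, D j i * z i =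
      p i₀ * z (i₀.succAbove j) - p (i₀.succAbove j) * z i₀ := by
    intro j z
    simp [D, sub_mul, ite_mul, Finset.sum_sub_distrib]
  ext i j
  rw [Matrix.mul_apply]
  refine Fin.cases ?_ (fun i => ?_) i <;> refine Fin.cases ?_ (fun j => ?_) j
  · change ∑ k, β k * (↑u⁻¹ * p k) = (1 : Matrix _ _ R) 0 0
    rw [Matrix.one_apply_eq]
    simp only [mul_left_comm (β _)]
    rw [← Finset.mul_sum, ← hu, Units.inv_mul]
  · have : ∑ i, β i * V' j i = 0 := by
      have h1 : ∀ i, β i * V' j i = ↑v⁻¹ * ((if i = i₀.succAbove j then β i else 0) -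
          ↑u⁻¹ * β (i₀.succAbove j) * (β i * p i)) := by
        intro i
        simp only [V']
        split_ifs <;> ring
      simp only [h1]
      rw [← Finset.mul_sum, Finset.sum_sub_distrib, ← Finset.mul_sum, ← hu]
      simp [mul_right_comm]
    exact this.trans (Matrix.one_apply_ne (Fin.succ_ne_zero j).symm).symm
  · refine (hD i fun k => ↑u⁻¹ * p k).trans ?_
    rw [Matrix.one_apply_ne (Fin.succ_ne_zero i)]
    ring
  · have h1 := hD i (V' j)
    have h2 : p i₀ * V' j (i₀.succAbove i) - p (i₀.succAbove i) * V' j i₀ =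
        if i = j then 1 else 0 := by
      simp only [V', ← hv, Fin.succAbove_right_inj, (Fin.succAbove_ne i₀ j).symm, if_false]
      split_ifs
      · linear_combination v.mul_inv
      · ring
    rw [h2] at h1
    refine h1.trans ?_
    simp [Matrix.one_apply]

lemma generalElts_of_isUnit {R : Type*} [CommRing R] [IsLocalRing R] {I : Ideal R} {i : ℕ}
    {P : (Fin i → R) → Prop}
    (h : ∀ (m : ℕ) (x : Fin m → R), Ideal.span (Set.range x) = I →
      ∃ F : MvPolynomial (Fin i × Fin m) R, (∃ c, IsUnit (F.eval c)) ∧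
        ∀ c, IsUnit (F.eval c) → P fun j => ∑ l, c (j, l) * x l) :
    GeneralElts (IsLocalRing.maximalIdeal R) I i P := by
  intro m x hx
  obtain ⟨F, ⟨c₀, hc₀⟩, hF⟩ := h m x hx
  have hev : ∀ c, MvPolynomial.eval (fun p => Ideal.Quotient.mk (IsLocalRing.maximalIdeal R) (c p))
      (MvPolynomial.map (Ideal.Quotient.mk (IsLocalRing.maximalIdeal R)) F) ≠ 0 ↔
      IsUnit (F.eval c) := by
    intro c
    rw [MvPolynomial.eval_map, ← IsLocalRing.notMem_maximalIdeal,
      ← Ideal.Quotient.eq_zero_iff_mem, MvPolynomial.eval₂_comp]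
    rfl
  refine ⟨F, fun h0 => ?_, fun c hc => hF c ((hev c).1 hc)⟩
  have := (hev c₀).2 hc₀
  rw [h0, map_zero] at this
  exact this rfl

/-- A finite generating family all of whose relations have coefficients in the maximal ideal. -/
lemma exists_minimal_generators {R : Type*} [CommRing R] [IsLocalRing R] {I : Ideal R} {d : ℕ}
    (hgen : ∃ g : Fin d → R, Ideal.span (Set.range g) = I) :
    ∃ r ≤ d, ∃ g : Fin r → R, Ideal.span (Set.range g) = I ∧
      ∀ c : Fin r → R, ∑ i, c i * g i = 0 → ∀ i, c i ∈ IsLocalRing.maximalIdeal R := by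
  classical
  have hex : ∃ r, ∃ g : Fin r → R, Ideal.span (Set.range g) = I := ⟨d, hgen⟩
  refine ⟨Nat.find hex, Nat.find_min' hex hgen, ?_⟩
  obtain ⟨g, hg⟩ := Nat.find_spec hex
  refine ⟨g, hg, fun c hc i => ?_⟩
  by_contra hi
  obtain ⟨u, hu⟩ := IsLocalRing.notMem_maximalIdeal.1 hi
  have hpos := i.pos
  obtain ⟨r, hr⟩ : ∃ r, Nat.find hex = r + 1 := ⟨Nat.find hex - 1, by omega⟩
  have hmin := Nat.find_min hex (show r < Nat.find hex by omega)
  clear hpos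
  generalize Nat.find hex = r' at *
  subst hr
  refine hmin ⟨fun j => g (i.succAbove j), ?_⟩
  rw [← hg]
  refine le_antisymm (Ideal.span_mono ?_) (Ideal.span_le.2 ?_)
  · rintro _ ⟨j, rfl⟩
    exact ⟨_, rfl⟩
  · rintro _ ⟨j, rfl⟩
    rcases Fin.eq_self_or_eq_succAbove i j with rfl | ⟨j, rfl⟩
    · rw [Fin.sum_univ_succAbove _ j, ← hu] at hc
      have : g j = ∑ k, (-↑u⁻¹ * c (j.succAbove k)) * g (j.succAbove k) := by
        simp only [mul_assoc]
        rw [← Finset.mul_sum, eq_neg_of_add_eq_zero_right hc, neg_mul_neg,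
          Units.inv_mul_cancel_left]
      rw [this]
      exact Ideal.sum_mem _ fun k _ => Ideal.mul_mem_left _ _ (Ideal.subset_span ⟨k, rfl⟩)
    · exact Ideal.subset_span ⟨j, rfl⟩

/-- Base change between a minimal and an arbitrary generating family. -/
lemma exists_matrix_of_minimal_generators {R : Type*} [CommRing R] [IsLocalRing R] {I : Ideal R}
    {r m : ℕ} {g : Fin r → R} (hg : Ideal.span (Set.range g) = I)
    (hmin : ∀ c : Fin r → R, ∑ i, c i * g i = 0 → ∀ i, c i ∈ IsLocalRing.maximalIdeal R)
    {x : Fin m → R} (hx : Ideal.span (Set.range x) = I) :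
    ∃ (E : Matrix (Fin m) (Fin r) R) (X : Matrix (Fin r) (Fin m) R), X * E = 1 ∧
      E.mulVec g = x := by
  have h1 : ∀ l, ∃ c : Fin r → R, ∑ i, c i * g i = x l := fun l =>
    Ideal.mem_span_range_iff_exists_fun.1 (by rw [hg, ← hx]; exact Ideal.subset_span ⟨l, rfl⟩)
  have h2 : ∀ i, ∃ c : Fin m → R, ∑ l, c l * x l = g i := fun i =>
    Ideal.mem_span_range_iff_exists_fun.1 (by rw [hx, ← hg]; exact Ideal.subset_span ⟨i, rfl⟩)
  choose E hE using h1
  choose X hX using h2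
  let E' : Matrix (Fin m) (Fin r) R := E
  let X' : Matrix (Fin r) (Fin m) R := X
  have hE' : E'.mulVec g = x := funext hE
  have hX' : X'.mulVec x = g := funext hX
  have hN : IsUnit (X' * E').det := by
    rw [← IsLocalRing.notMem_maximalIdeal, ← Ideal.Quotient.eq_zero_iff_mem, RingHom.map_det]
    have : (Ideal.Quotient.mk (IsLocalRing.maximalIdeal R)).mapMatrix (X' * E') = 1 := by
      rw [← sub_eq_zero, ← map_one (Ideal.Quotient.mk (IsLocalRing.maximalIdeal R)).mapMatrix,
        ← map_sub]
      ext i j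
      refine Ideal.Quotient.eq_zero_iff_mem.2 (hmin _ ?_ j)
      change (X' * E' - 1).mulVec g i = 0
      rw [Matrix.sub_mulVec, ← Matrix.mulVec_mulVec, hE', hX', Matrix.one_mulVec, sub_self]
      rfl
    rw [this, Matrix.det_one]
    exact one_ne_zero
  refine ⟨E', (X' * E')⁻¹ * X', ?_, hE'⟩
  rw [Matrix.mul_assoc, Matrix.nonsing_inv_mul _ hN]

lemma IsLocalRing.exists_isUnit_eval {R ι : Type*} [CommRing R] [IsLocalRing R]
    [Infinite (IsLocalRing.ResidueField R)] {t : MvPolynomial ι R}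
    (ht : t ∉ residueKer (IsLocalRing.maximalIdeal R) ι) : ∃ p, IsUnit (t.eval p) := by
  have h0 : MvPolynomial.map (IsLocalRing.residue R) t ≠ 0 := fun h => ht (RingHom.mem_ker.2 h)
  by_contra! hcon
  refine h0 (MvPolynomial.funext fun p => ?_)
  obtain ⟨p, rfl⟩ := (IsLocalRing.residue_surjective (R := R)).comp_left p
  rw [MvPolynomial.eval_map, map_zero]
  refine (MvPolynomial.eval₂_comp _ p _).symm.trans ?_
  rw [IsLocalRing.residue_eq_zero_iff]
  exact hcon p

lemma MvPolynomial.IsHomogeneous.eval_adjugate {R n : Type*} [CommRing R] [Fintype n]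
    [DecidableEq n] {t : MvPolynomial n R} {e : ℕ} (ht : t.IsHomogeneous e) {W V : Matrix n n R}
    (h : W * V = 1) (j : n) :
    t.eval (fun i => W.adjugate i j) = W.det ^ e * t.eval (fun i => V i j) := by
  have : W.adjugate = W.det • V := by
    rw [← mul_one W.adjugate, ← h, ← mul_assoc, Matrix.adjugate_mul, Matrix.smul_mul, one_mul]
  rw [this, ← ht.eval_mul_left]
  rfl

section Main

variable {R M : Type*} [CommRing R] [IsNoetherianRing R] [IsLocalRing R]
  [AddCommGroup M] [Module R M] [Module.Finite R M] {I : Ideal R}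

lemma generalElts_of_minimal_generators [Infinite (IsLocalRing.ResidueField R)] {q : ℕ}
    (hdim : mDim R M ≤ ((q + 1 : ℕ) : WithBot ℕ∞)) {g : Fin (q + 1) → R}
    (hg : Ideal.span (Set.range g) = I)
    (hmin : ∀ c : Fin (q + 1) → R, ∑ i, c i * g i = 0 → ∀ i, c i ∈ IsLocalRing.maximalIdeal R)
    {b : R} (hbI : b ∈ I) (hbmI : b ∉ IsLocalRing.maximalIdeal R * I) :
    GeneralElts (IsLocalRing.maximalIdeal R) I q fun a =>
      Ideal.span (insert b (Set.range a)) = I ∧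
      jMult (IsLocalRing.maximalIdeal R) I M (q + 1) =
        ((mLength R (M ⧸ (satur I (Ideal.span (Set.range a) • ⊤ : Submodule R M) ⊔
          Ideal.span {b} • ⊤))).toNat : ℝ) := by
  refine generalElts_of_isUnit fun m x hx => ?_
  obtain ⟨E, X, hXE, hEx⟩ := exists_matrix_of_minimal_generators hg hmin hx
  obtain ⟨β, hβ⟩ := Ideal.mem_span_range_iff_exists_fun.1 (hg ▸ hbI)
  obtain ⟨t, e, hte, ht, hmain⟩ := exists_form_jMult_eq hdim hg
  let W : (Fin q × Fin m → R) → Matrix (Fin (q + 1)) (Fin (q + 1)) R := fun c =>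
    Matrix.of (Fin.cons β (Matrix.of (fun j l => c (j, l)) * E))
  let W' : Matrix (Fin (q + 1)) (Fin (q + 1)) (MvPolynomial (Fin q × Fin m) R) :=
    Matrix.of (Fin.cons (fun i => MvPolynomial.C (β i))
      fun j i => ∑ l, MvPolynomial.X (j, l) * MvPolynomial.C (E l i))
  have hW : ∀ c, (MvPolynomial.eval c).mapMatrix W' = W c := by
    intro c
    ext i j
    refine Fin.cases ?_ (fun i => ?_) i
    · exact MvPolynomial.eval_C _
    · change MvPolynomial.eval c (∑ l, MvPolynomial.X (i, l) * MvPolynomial.C (E l j)) =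
        ∑ l, c (i, l) * E l j
      simp
  let F := W'.det * MvPolynomial.aeval (fun i => W'.adjugate i 0) t
  have hF : ∀ c, F.eval c = (W c).det * t.eval (fun i => (W c).adjugate i 0) := by
    intro c
    have h2 : ∀ i, MvPolynomial.eval c (W'.adjugate i 0) = (W c).adjugate i 0 := by
      intro i
      rw [← hW, ← RingHom.map_adjugate]
      rfl
    rw [map_mul, RingHom.map_det, hW, MvPolynomial.aeval_def, MvPolynomial.hom_eval₂]
    simp only [h2]
    congr 1
    have hcomp : (MvPolynomial.eval c).comp
        (algebraMap R (MvPolynomial (Fin q × Fin m) R)) = RingHom.id R := by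
      ext; simp [MvPolynomial.algebraMap_eq]
    rw [hcomp]
    rfl
  refine ⟨F, ?_, fun c hc => ?_⟩
  · obtain ⟨i₁, hi₁⟩ : ∃ i, β i ∉ IsLocalRing.maximalIdeal R := by
      by_contra! hcon
      refine hbmI (hβ ▸ Ideal.sum_mem _ fun i _ => Ideal.mul_mem_mul (hcon i) ?_)
      exact hg ▸ Ideal.subset_span (Set.mem_range_self i)
    have hs : ∑ i, MvPolynomial.C (β i) * MvPolynomial.X i ∉
        residueKer (IsLocalRing.maximalIdeal R) (Fin (q + 1)) := by
      intro h
      have h1 := mem_residueKer.1 h (Finsupp.single i₁ 1)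
      refine hi₁ ?_
      simpa [MvPolynomial.coeff_sum, MvPolynomial.coeff_C_mul, MvPolynomial.coeff_X,
        Finsupp.single_left_inj] using h1
    obtain ⟨p, hp⟩ := IsLocalRing.exists_isUnit_eval
      (Ideal.IsPrime.mul_notMem inferInstance ht hs)
    rw [map_mul, IsUnit.mul_iff] at hp
    obtain ⟨htp, hsp⟩ := hp
    replace hsp : IsUnit (∑ i, β i * p i) := by simpa using hsp
    obtain ⟨i₀, hi₀⟩ : ∃ i, IsUnit (p i) := by
      by_contra! hcon
      exact IsLocalRing.notMem_maximalIdeal.2 hsp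
        (Ideal.sum_mem _ fun i _ => Ideal.mul_mem_left _ _ (hcon i))
    obtain ⟨D, V, u, hu, hDV, hV⟩ := exists_matrix_mul_eq_one hsp hi₀
    refine ⟨fun jl => (D * X) jl.1 jl.2, ?_⟩
    have hWD : W (fun jl => (D * X) jl.1 jl.2) = Matrix.of (Fin.cons β D) := by
      change Matrix.of (Fin.cons β (D * X * E)) = _
      rw [Matrix.mul_assoc, hXE, Matrix.mul_one]
    rw [hF, hWD, hte.eval_adjugate hDV]
    simp only [hV]
    rw [hte.eval_mul_left]
    have hdet := Matrix.isUnit_det_of_right_inverse hDV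
    exact hdet.mul ((hdet.pow e).mul ((hu.pow e).mul htp))
  · rw [hF, IsUnit.mul_iff] at hc
    have hWV : W c * (W c)⁻¹ = 1 := Matrix.mul_nonsing_inv _ hc.1
    have hcoord := isCoord_of_matrix hWV g
    have h0 : (W c).mulVec g 0 = b := hβ
    have h1 : (fun j : Fin q => (W c).mulVec g j.succ) = fun j => ∑ l, c (j, l) * x l := by
      funext j
      change ((Matrix.of (fun j l => c (j, l)) : Matrix _ _ R) * E).mulVec g j = _
      rw [← Matrix.mulVec_mulVec, hEx]
      rfl
    rw [h0, h1] at hcoord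
    refine ⟨?_, hmain _ _ _ hcoord ?_⟩
    · rw [Ideal.span_insert, ← hcoord.span_eq, hg]
    · rw [hte.eval_adjugate hWV, IsUnit.mul_iff] at hc
      exact hc.2.2

lemma generalElts_of_lt_generators {q r : ℕ} (hr : r + 1 < q + 1) {g : Fin (r + 1) → R}
    (hg : Ideal.span (Set.range g) = I)
    (hmin : ∀ c : Fin (r + 1) → R, ∑ i, c i * g i = 0 → ∀ i, c i ∈ IsLocalRing.maximalIdeal R)
    {b : R} (hbI : b ∈ I) :
    GeneralElts (IsLocalRing.maximalIdeal R) I q fun a =>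
      Ideal.span (insert b (Set.range a)) = I ∧
      jMult (IsLocalRing.maximalIdeal R) I M (q + 1) =
        ((mLength R (M ⧸ (satur I (Ideal.span (Set.range a) • ⊤ : Submodule R M) ⊔
          Ideal.span {b} • ⊤))).toNat : ℝ) := by
  have hrq : r + 1 ≤ q := by omega
  refine generalElts_of_isUnit fun m x hx => ?_
  obtain ⟨E, X, hXE, hEx⟩ := exists_matrix_of_minimal_generators hg hmin hx
  let W : (Fin q × Fin m → R) → Matrix (Fin (r + 1)) (Fin (r + 1)) R := fun c =>
    Matrix.of (fun j l => c (Fin.castLE hrq j, l)) * E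
  let W' : Matrix (Fin (r + 1)) (Fin (r + 1)) (MvPolynomial (Fin q × Fin m) R) :=
    fun j i => ∑ l, MvPolynomial.X (Fin.castLE hrq j, l) * MvPolynomial.C (E l i)
  have hF : ∀ c, W'.det.eval c = (W c).det := by
    intro c
    rw [RingHom.map_det]
    congr 1
    ext i j
    change MvPolynomial.eval c
      (∑ l, MvPolynomial.X (Fin.castLE hrq i, l) * MvPolynomial.C (E l j)) =
        ∑ l, c (Fin.castLE hrq i, l) * E l j
    simp
  refine ⟨W'.det, ⟨fun jl => if h : jl.1.1 < r + 1 then X ⟨jl.1.1, h⟩ jl.2 else 0, ?_⟩,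
    fun c hc => ?_⟩
  · rw [hF]
    have : W (fun jl => if h : jl.1.1 < r + 1 then X ⟨jl.1.1, h⟩ jl.2 else 0) = 1 := by
      rw [← hXE]
      simp only [W]
      congr 1
      ext j l
      exact dif_pos j.2
    rw [this, Matrix.det_one]
    exact isUnit_one
  · rw [hF] at hc
    set a : Fin q → R := fun j => ∑ l, c (j, l) * x l
    have hspan : Ideal.span (Set.range a) = I := by
      refine le_antisymm (Ideal.span_le.2 ?_) ?_
      · rintro _ ⟨j, rfl⟩
        exact Ideal.sum_mem _ fun l _ => Ideal.mul_mem_left _ _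
          (hx ▸ Ideal.subset_span ⟨l, rfl⟩)
      · rw [← hg, Ideal.span_le]
        rintro _ ⟨i, rfl⟩
        have h1 : (W c).mulVec g = fun j => a (Fin.castLE hrq j) := by
          rw [← Matrix.mulVec_mulVec, hEx]
          rfl
        have h2 : g = (W c)⁻¹.mulVec ((W c).mulVec g) := by
          rw [Matrix.mulVec_mulVec, Matrix.nonsing_inv_mul _ hc, Matrix.one_mulVec]
        rw [h2, h1]
        change ∑ j, (W c)⁻¹ i j * a (Fin.castLE hrq j) ∈ Ideal.span (Set.range a)
        exact Ideal.sum_mem _ fun j _ => Ideal.mul_mem_left _ ((W c)⁻¹ i j)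
          (Ideal.subset_span (Set.mem_range_self (Fin.castLE hrq j)))
    refine ⟨?_, ?_⟩
    · rw [Ideal.span_insert, hspan]
      exact sup_eq_right.2 ((Ideal.span_singleton_le_iff_mem _).2 hbI)
    · have hsat : satur I (Ideal.span (Set.range a) • ⊤ : Submodule R M) = ⊤ := by
        rw [hspan, eq_top_iff]
        intro y _
        exact mem_satur.2 ⟨1, fun z hz => Submodule.smul_mem_smul (by simpa using hz) trivial⟩
      rw [jMult_eq_zero hg hr, hsat, top_sup_eq, mLength_eq_length, Module.length_eq_zero]
      simp

end Main

/-- Remark 3.11: if `I` is generated by `d` elements and `b ∈ I \ 𝔪I`, then one can choose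
general elements `a₁, …, a_{d−1}` of `I` generating `I` together with `b`, and then
`j_d(I, M) = length_R (M/(((a₁, …, a_{d−1})M :_M I^∞) + bM))`. -/
theorem stmt_11 {R : Type*} [CommRing R] [IsNoetherianRing R] [IsLocalRing R]
    (hdim : 0 < ringKrullDim R) (hres : Infinite (IsLocalRing.ResidueField R))
    (I : Ideal R) (hI : I ≠ ⊤)
    (M : Type*) [AddCommGroup M] [Module R M] [Module.Finite R M]
    (d : ℕ) (hd : 0 < d) (hMd : mDim R M ≤ (d : WithBot ℕ∞))
    (hgen : ∃ g : Fin d → R, Ideal.span (Set.range g) = I)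
    (b : R) (hbI : b ∈ I) (hbmI : b ∉ IsLocalRing.maximalIdeal R * I) :
    GeneralElts (IsLocalRing.maximalIdeal R) I (d - 1) fun a =>
      Ideal.span (insert b (Set.range a)) = I ∧
      jMult (IsLocalRing.maximalIdeal R) I M d =
        ((mLength R (M ⧸ (satur I (Ideal.span (Set.range a) • ⊤ : Submodule R M) ⊔
          Ideal.span {b} • ⊤))).toNat : ℝ) := by
  have := hres
  obtain ⟨q, rfl⟩ : ∃ q, d = q + 1 := ⟨d - 1, by omega⟩
  change GeneralElts _ I q _
  obtain ⟨r, hr, g, hg, hmin⟩ := exists_minimal_generators hgen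
  rcases r with _ | r
  · refine absurd ?_ hbmI
    rw [← hg] at hbI
    rw [show b = 0 by simpa using hbI]
    exact Ideal.zero_mem _
  · rcases hr.eq_or_lt with h | h
    · obtain rfl : r = q := by omega
      exact generalElts_of_minimal_generators hMd hg hmin hbI hbmI
    · exact generalElts_of_lt_generators h hg hmin hbI

end
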